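/- arXiv:cond-mat/0404107 — 12 statements merged into one kernel-verified Lean document; each statement's English description precedes it below -/
import Mathlib

section
/- In the Vasicek model, if there exists r > 0 such that the bond price τ ↦ P(r,τ) is nonincreasing on [0,∞), then σ²/2 ≤ κθ. -/
/-- **Vasicek model, necessary condition.**
If there exists `r > 0` such that the bond price `τ ↦ P r τ` is nonincreasing on `[0,∞)`,
then `σ²/2 ≤ κθ`. -/
theorem stmt_0 (θ κ σ : ℝ) (hθ : 0 < θ) (hκ : 0 < κ) (hσ : 0 < σ)
    (B : ℝ → ℝ) (hB : ∀ τ, B τ = -κ⁻¹ * (1 - Real.exp (-(κ * τ))))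
    (C : ℝ → ℝ) (hC : ∀ τ, C τ = ∫ s in (0:ℝ)..τ, (θ * B s + σ ^ 2 / 2 * B s ^ 2))
    (P : ℝ → ℝ → ℝ) (hP : ∀ r τ, P r τ = Real.exp (B τ * r + C τ))
    (hmono : ∃ r > (0:ℝ), AntitoneOn (P r) (Set.Ici 0)) :
    σ ^ 2 / 2 ≤ κ * θ := by
  obtain ⟨r, hr, hanti⟩ := hmono
  have hBfun : B = fun τ => -κ⁻¹ * (1 - Real.exp (-(κ * τ))) := funext hB
  have hBc : Continuous B := by rw [hBfun]; fun_prop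
  have hg : Continuous (fun s => θ * B s + σ ^ 2 / 2 * B s ^ 2) := by fun_prop
  have hBd : ∀ τ, HasDerivAt B (-Real.exp (-(κ * τ))) τ := by
    intro τ
    have h1 : HasDerivAt (fun t : ℝ => -(κ * t)) (-(κ * 1)) τ :=
      ((hasDerivAt_id τ).const_mul κ).neg
    have h2 := (h1.exp.const_sub 1).const_mul (-κ⁻¹)
    rw [hBfun]
    refine h2.congr_deriv ?_
    have hk : κ⁻¹ * κ = 1 := inv_mul_cancel₀ hκ.ne'
    linear_combination (-Real.exp (-(κ * τ))) * hk
  have hCd : ∀ τ, HasDerivAt C (θ * B τ + σ ^ 2 / 2 * B τ ^ 2) τ := by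
    intro τ
    rw [show C = fun τ => ∫ s in (0:ℝ)..τ, (θ * B s + σ ^ 2 / 2 * B s ^ 2) from funext hC]
    exact hg.integral_hasStrictDerivAt 0 τ |>.hasDerivAt
  have hf : AntitoneOn (fun τ => B τ * r + C τ) (Set.Ici 0) := by
    intro a ha b hb hab
    have := hanti ha hb hab
    rw [hP, hP] at this
    exact Real.exp_le_exp.mp this
  have hd : ∀ τ, 0 ≤ τ → -Real.exp (-(κ * τ)) * r + (θ * B τ + σ ^ 2 / 2 * B τ ^ 2) ≤ 0 := by
    intro τ hτ
    have h1 := (((hBd τ).mul_const r).add (hCd τ)).hasDerivWithinAt (s := Set.Ici 0)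
    have h2 := h1.derivWithin (uniqueDiffOn_Ici (0:ℝ) τ hτ)
    rw [← h2]
    exact hf.derivWithin_nonpos
  have hE : Filter.Tendsto (fun τ => Real.exp (-(κ * τ))) Filter.atTop (nhds 0) :=
    Real.tendsto_exp_neg_atTop_nhds_zero.comp (Filter.tendsto_id.const_mul_atTop hκ)
  have hBl : Filter.Tendsto B Filter.atTop (nhds (-κ⁻¹ * (1 - 0))) := by
    rw [hBfun]
    exact (hE.const_sub 1).const_mul _
  have hl := (hE.neg.mul_const r).add ((hBl.const_mul θ).add ((hBl.pow 2).const_mul (σ ^ 2 / 2)))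
  have hle := le_of_tendsto hl ((Filter.eventually_ge_atTop 0).mono hd)
  have key : (-0 * r + (θ * (-κ⁻¹ * (1 - 0)) + σ ^ 2 / 2 * (-κ⁻¹ * (1 - 0)) ^ 2)) * κ ^ 2
      = σ ^ 2 / 2 - κ * θ := by
    field_simp
    ring
  have := mul_nonpos_of_nonpos_of_nonneg hle (sq_nonneg κ)
  linarith
end

section
/- In the Vasicek model, if σ²/2 ≤ κθ, then for every r > 0 the bond price τ ↦ P(r,τ) is strictly decreasing on [0,∞). -/
/-- **Vasicek model, sufficient condition.**
If `σ²/2 ≤ κθ`, then for every `r > 0` the bond price `τ ↦ P r τ` is strictly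
decreasing on `[0,∞)`. -/
theorem stmt_1 (θ κ σ : ℝ) (hθ : 0 < θ) (hκ : 0 < κ) (hσ : 0 < σ)
    (B : ℝ → ℝ) (hB : ∀ τ, B τ = -κ⁻¹ * (1 - Real.exp (-(κ * τ))))
    (C : ℝ → ℝ) (hC : ∀ τ, C τ = ∫ s in (0:ℝ)..τ, (θ * B s + σ ^ 2 / 2 * B s ^ 2))
    (P : ℝ → ℝ → ℝ) (hP : ∀ r τ, P r τ = Real.exp (B τ * r + C τ))
    (hcond : σ ^ 2 / 2 ≤ κ * θ) :
    ∀ r > (0:ℝ), StrictAntiOn (P r) (Set.Ici 0) := by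
  intro r hr
  have hBf : B = fun τ => -κ⁻¹ * (1 - Real.exp (-(κ * τ))) := funext hB
  have hBcont : Continuous B := by
    rw [hBf]; fun_prop
  have hBd : ∀ τ, HasDerivAt B (-Real.exp (-(κ * τ))) τ := by
    intro τ
    rw [hBf]
    have h1 : HasDerivAt (fun τ : ℝ => -(κ * τ)) (-(κ * 1)) τ :=
      ((hasDerivAt_id τ).const_mul κ).neg
    have h2 := (h1.exp.const_sub 1).const_mul (-κ⁻¹)
    have h3 : -κ⁻¹ * -(Real.exp (-(κ * τ)) * -(κ * 1)) = -Real.exp (-(κ * τ)) := by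
      field_simp
    rw [h3] at h2
    exact h2
  have hCd : ∀ τ, HasDerivAt C (θ * B τ + σ ^ 2 / 2 * B τ ^ 2) τ := by
    intro τ
    have hcont : Continuous (fun s => θ * B s + σ ^ 2 / 2 * B s ^ 2) := by fun_prop
    have h := hcont.integral_hasStrictDerivAt 0 τ
    rw [show C = fun τ => ∫ s in (0:ℝ)..τ, (θ * B s + σ ^ 2 / 2 * B s ^ 2) from funext hC]
    exact h.hasDerivAt
  have hE : ∀ τ, HasDerivAt (fun τ => B τ * r + C τ)
      (-Real.exp (-(κ * τ)) * r + (θ * B τ + σ ^ 2 / 2 * B τ ^ 2)) τ :=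
    fun τ => ((hBd τ).mul_const r).add (hCd τ)
  have hanti : StrictAntiOn (fun τ => B τ * r + C τ) (Set.Ici 0) := by
    apply strictAntiOn_of_deriv_neg (convex_Ici 0)
    · exact fun τ _ => (hE τ).continuousAt.continuousWithinAt
    · intro τ hτ
      rw [interior_Ici, Set.mem_Ioi] at hτ
      rw [(hE τ).deriv]
      have he := Real.exp_pos (-(κ * τ))
      have he1 : Real.exp (-(κ * τ)) ≤ 1 :=
        Real.exp_le_one_iff.mpr (by nlinarith)
      have hk : κ * B τ = -(1 - Real.exp (-(κ * τ))) := by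
        rw [hB]; field_simp
      have hB0 : B τ ≤ 0 := by
        by_contra hcon
        push Not at hcon
        nlinarith [mul_pos hκ hcon]
      have h1 : 0 ≤ θ + σ ^ 2 / 2 * B τ := by
        have h2 : κ * θ * B τ ≤ σ ^ 2 / 2 * B τ :=
          mul_le_mul_of_nonpos_right hcond hB0
        have h3 : κ * θ * B τ = θ * (-(1 - Real.exp (-(κ * τ)))) := by
          rw [← hk]; ring
        nlinarith [mul_pos hθ he]
      nlinarith [mul_nonneg h1 (neg_nonneg.mpr hB0), mul_pos he hr]
  intro a ha b hb hab
  rw [hP, hP]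
  exact Real.exp_lt_exp.mpr (hanti ha hb hab)
end

section
/- In the A₀(n) model with n = 2 (so κ = [[κ₁₁,0],[κ₂₁,κ₂₂]] with κ₁₁, κ₂₂ > 0, d₁ ≥ 0, d₂ > 0), if the first component B₁ of B is nonincreasing on [0,∞), then d₁κ₂₂ - d₂κ₂₁ ≥ 0. -/
/-- **A₀(2) model, necessary condition.**
If the first component `B₁` of `B` is nonincreasing on `[0,∞)`, then
`d₁κ₂₂ - d₂κ₂₁ ≥ 0`.  Here `B` solves `B' = -κᵀB - d`, `B(0) = 0`, with
`κ = [[κ₁₁,0],[κ₂₁,κ₂₂]]` lower triangular with positive diagonal, `d₁ ≥ 0`, `d₂ > 0`. -/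
theorem stmt_2 (κ₁₁ κ₂₁ κ₂₂ d₁ d₂ : ℝ)
    (hκ₁₁ : 0 < κ₁₁) (hκ₂₂ : 0 < κ₂₂) (hd₁ : 0 ≤ d₁) (hd₂ : 0 < d₂)
    (B₁ B₂ : ℝ → ℝ) (hB₁0 : B₁ 0 = 0) (hB₂0 : B₂ 0 = 0)
    (hB₁ : ∀ τ ∈ Set.Ici (0:ℝ),
      HasDerivWithinAt B₁ (-(κ₁₁ * B₁ τ) - κ₂₁ * B₂ τ - d₁) (Set.Ici 0) τ)
    (hB₂ : ∀ τ ∈ Set.Ici (0:ℝ),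
      HasDerivWithinAt B₂ (-(κ₂₂ * B₂ τ) - d₂) (Set.Ici 0) τ)
    (hmono : AntitoneOn B₁ (Set.Ici 0)) :
    0 ≤ d₁ * κ₂₂ - d₂ * κ₂₁ := by
  by_contra hneg
  have hc : 0 < d₂ * κ₂₁ - d₁ * κ₂₂ := by linarith
  have hκ₂₁ : 0 < κ₂₁ := by
    have h1 : 0 ≤ d₁ * κ₂₂ := by positivity
    have h2 : 0 < d₂ * κ₂₁ := by linarith
    exact (mul_pos_iff_of_pos_left hd₂).1 h2
  have hB₁np : ∀ t ∈ Set.Ici (0:ℝ), B₁ t ≤ 0 := fun t ht => by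
    have := hmono (Set.mem_Ici.2 le_rfl) ht ht
    linarith
  -- `F = κ₂₂ B₁ - κ₂₁ B₂ - c τ` is nondecreasing
  have hF : MonotoneOn
      (fun t => κ₂₂ * B₁ t - κ₂₁ * B₂ t - (d₂ * κ₂₁ - d₁ * κ₂₂) * t) (Set.Ici 0) := by
    have hd : ∀ t ∈ Set.Ici (0:ℝ), HasDerivWithinAt
        (fun t => κ₂₂ * B₁ t - κ₂₁ * B₂ t - (d₂ * κ₂₁ - d₁ * κ₂₂) * t)
        (-(κ₂₂ * κ₁₁ * B₁ t)) (Set.Ici 0) t := fun t ht => by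
      have := (((hB₁ t ht).const_mul κ₂₂).sub ((hB₂ t ht).const_mul κ₂₁)).sub
        ((hasDerivWithinAt_id t (Set.Ici 0)).const_mul (d₂ * κ₂₁ - d₁ * κ₂₂))
      refine this.congr_deriv ?_
      ring
    refine monotoneOn_of_hasDerivWithinAt_nonneg (convex_Ici 0)
      (fun t ht => (hd t ht).continuousWithinAt)
      (fun t ht => (hd t (interior_subset ht)).mono interior_subset) (fun t ht => ?_)
    have h1 := hB₁np t (interior_subset ht)
    have h2 : 0 < κ₂₂ * κ₁₁ := by positivity
    nlinarith
  -- `(κ₂₂ B₂ + d₂)²` is nonincreasing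
  have hG : AntitoneOn (fun t => (κ₂₂ * B₂ t + d₂) ^ 2) (Set.Ici 0) := by
    have hd : ∀ t ∈ Set.Ici (0:ℝ), HasDerivWithinAt
        (fun t => (κ₂₂ * B₂ t + d₂) ^ 2)
        (-(2 * κ₂₂ * (κ₂₂ * B₂ t + d₂) ^ 2)) (Set.Ici 0) t := fun t ht => by
      have := (((hB₂ t ht).const_mul κ₂₂).add_const d₂).pow 2
      refine this.congr_deriv ?_
      push_cast
      ring
    refine antitoneOn_of_hasDerivWithinAt_nonpos (convex_Ici 0)
      (fun t ht => (hd t ht).continuousWithinAt)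
      (fun t ht => (hd t (interior_subset ht)).mono interior_subset) (fun t ht => ?_)
    have : 0 ≤ 2 * κ₂₂ * (κ₂₂ * B₂ t + d₂) ^ 2 := by positivity
    linarith
  obtain ⟨T, hT⟩ : ∃ T, T = (2 * d₂ + 1) * κ₂₁ / (κ₂₂ * (d₂ * κ₂₁ - d₁ * κ₂₂)) := ⟨_, rfl⟩
  have hT0 : 0 ≤ T := by rw [hT]; positivity
  have hTc : κ₂₂ * ((d₂ * κ₂₁ - d₁ * κ₂₂) * T) = (2 * d₂ + 1) * κ₂₁ := by
    rw [hT, ← mul_assoc]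
    exact mul_div_cancel_of_imp' (fun h => absurd h (mul_pos hκ₂₂ hc).ne')
  have h1 := hF (Set.mem_Ici.2 le_rfl) (Set.mem_Ici.2 hT0) hT0
  have h2 := hG (Set.mem_Ici.2 le_rfl) (Set.mem_Ici.2 hT0) hT0
  have h3 := hB₁np T hT0
  simp only [hB₁0, hB₂0, mul_zero, sub_zero, zero_add] at h1 h2
  have h4 : -d₂ ≤ κ₂₂ * B₂ T + d₂ := (abs_le_of_sq_le_sq' h2 hd₂.le).1
  have h5 : (d₂ * κ₂₁ - d₁ * κ₂₂) * T ≤ -(κ₂₁ * B₂ T) := by nlinarith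
  have h6 := mul_le_mul_of_nonneg_left h5 hκ₂₂.le
  rw [hTc] at h6
  have h7 := mul_le_mul_of_nonneg_left h4 hκ₂₁.le
  nlinarith
end

section
/- In the A₀(n) model (n ≥ 2), if for every x ∈ ℝⁿ with all coordinates nonnegative the bond price τ ↦ P(x,τ) is nonincreasing on [0,∞), then Q(-γ) ≤ 0. -/
open Filter Topology in
theorem aux_upper (a : ℝ) (ha : 0 < a) (u g : ℝ → ℝ)
    (hu : ∀ t ∈ Set.Ici (0:ℝ), HasDerivWithinAt u (-(a * u t) + g t) (Set.Ici 0) t)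
    (hg : Tendsto g atTop (𝓝 0)) (ε : ℝ) (hε : 0 < ε) : ∀ᶠ t in atTop, u t < ε := by
  have h1 : ∀ᶠ t in atTop, g t < a * (ε / 2) := hg.eventually_lt_const (by positivity)
  obtain ⟨T0, hT0⟩ := eventually_atTop.1 h1
  set T := max T0 0 with hT
  have hTn : 0 ≤ T := le_max_right _ _
  have hd : ∀ t ∈ Set.Ici T, HasDerivWithinAt (fun t => Real.exp (a * t) * (u t - ε / 2))
      (Real.exp (a * t) * (g t - a * (ε / 2))) (Set.Ici T) t := by
    intro t ht
    have h2 := (hu t (le_trans hTn ht)).mono (Set.Ici_subset_Ici.2 hTn)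
    have h3 : HasDerivWithinAt (fun t => Real.exp (a * t)) (Real.exp (a * t) * (a * 1))
        (Set.Ici T) t := (((hasDerivAt_id t).const_mul a).exp).hasDerivWithinAt
    have h4 := h3.mul (h2.sub_const (ε / 2))
    refine h4.congr_deriv ?_
    ring
  have hanti : AntitoneOn (fun t => Real.exp (a * t) * (u t - ε / 2)) (Set.Ici T) := by
    refine antitoneOn_of_hasDerivWithinAt_nonpos (convex_Ici T)
      (f' := fun t => Real.exp (a * t) * (g t - a * (ε / 2)))
      (fun t ht => (hd t ht).continuousWithinAt) ?_ ?_
    · intro t ht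
      exact (hd t (interior_subset ht)).mono interior_subset
    · intro t ht
      have h5 := hT0 t (le_trans (le_max_left _ _) (interior_subset ht : t ∈ Set.Ici T))
      exact mul_nonpos_of_nonneg_of_nonpos (Real.exp_pos _).le (by linarith)
  set K := Real.exp (a * T) * (u T - ε / 2) with hK
  have hlim : Tendsto (fun t => K * Real.exp (-(a * t))) atTop (𝓝 0) := by
    have : Tendsto (fun t => Real.exp (-(a * t))) atTop (𝓝 0) :=
      Real.tendsto_exp_neg_atTop_nhds_zero.comp (tendsto_id.const_mul_atTop ha)
    simpa using this.const_mul K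
  filter_upwards [hlim.eventually_lt_const (half_pos hε), eventually_ge_atTop T] with t h6 h7
  have h8 : Real.exp (a * t) * (u t - ε / 2) ≤ K := hanti Set.self_mem_Ici h7 h7
  have h9 := mul_le_mul_of_nonneg_right h8 (Real.exp_pos (-(a * t))).le
  have h10 : Real.exp (a * t) * Real.exp (-(a * t)) = 1 := by
    rw [← Real.exp_add]; simp
  have h11 : Real.exp (a * t) * (u t - ε / 2) * Real.exp (-(a * t)) = u t - ε / 2 := by
    calc _ = (Real.exp (a * t) * Real.exp (-(a * t))) * (u t - ε / 2) := by ring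
      _ = _ := by rw [h10, one_mul]
  linarith

open Filter Topology in
theorem aux_tendsto (a : ℝ) (ha : 0 < a) (u g : ℝ → ℝ)
    (hu : ∀ t ∈ Set.Ici (0:ℝ), HasDerivWithinAt u (-(a * u t) + g t) (Set.Ici 0) t)
    (hg : Tendsto g atTop (𝓝 0)) : Tendsto u atTop (𝓝 0) := by
  rw [Metric.tendsto_nhds]
  intro ε hε
  have h1 := aux_upper a ha u g hu hg ε hε
  have h2 := aux_upper a ha (fun t => -u t) (fun t => -g t)
    (fun t ht => ((hu t ht).fun_neg).congr_deriv (by ring)) (by simpa using hg.neg) ε hε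
  filter_upwards [h1, h2] with t h3 h4
  rw [Real.dist_eq, sub_zero, abs_lt]
  constructor <;> linarith

/-- **A₀(n) model, necessary condition.**
If for every `x ∈ ℝⁿ` with all coordinates nonnegative the bond price `τ ↦ P x τ`
is nonincreasing on `[0,∞)`, then `Q(-γ) ≤ 0`. -/
theorem stmt_3 (n : ℕ) (hn : 2 ≤ n)
    (κ : Matrix (Fin n) (Fin n) ℝ)
    (hκlow : ∀ i j : Fin n, i < j → κ i j = 0)
    (hκdiag : ∀ i : Fin n, 0 < κ i i)
    (d : Fin n → ℝ) (hd : ∀ j, 0 ≤ d j) (hdn : 0 < d ⟨n - 1, by omega⟩)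
    (d₀ : ℝ) (θ : Fin n → ℝ)
    (S : Matrix (Fin n) (Fin n) ℝ) (hS : S.PosDef)
    (γ : Fin n → ℝ) (hγ : κ.transpose.mulVec γ = d)
    (B : ℝ → Fin n → ℝ) (hB0 : B 0 = 0)
    (hB : ∀ τ ∈ Set.Ici (0:ℝ),
      HasDerivWithinAt B (-(κ.transpose.mulVec (B τ)) - d) (Set.Ici 0) τ)
    (Q : (Fin n → ℝ) → ℝ)
    (hQ : ∀ y, Q y = -d₀ + (∑ j, θ j * y j) + (1 / 2) * ∑ j, (S.transpose.mulVec y j) ^ 2)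
    (C : ℝ → ℝ) (hC : ∀ τ, C τ = ∫ s in (0:ℝ)..τ, Q (B s))
    (P : (Fin n → ℝ) → ℝ → ℝ)
    (hP : ∀ x τ, P x τ = Real.exp ((∑ j, B τ j * x j) + C τ))
    (hmono : ∀ x : Fin n → ℝ, (∀ j, 0 ≤ x j) → AntitoneOn (P x) (Set.Ici 0)) :
    Q (fun j => -γ j) ≤ 0 := by
  have hE : ∀ m : ℕ, ∀ i : Fin n, n - 1 - i.val = m →
      Filter.Tendsto (fun t => B t i + γ i) Filter.atTop (nhds 0) := by
    intro m
    induction m using Nat.strong_induction_on with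
    | _ m ih =>
      intro i hi
      refine aux_tendsto (κ i i) (hκdiag i) _
        (fun t => -∑ j ∈ Finset.univ.erase i, κ j i * (B t j + γ j)) ?_ ?_
      · intro t ht
        have h1 := (hasDerivWithinAt_pi.1 (hB t ht) i).add_const (γ i)
        refine h1.congr_deriv ?_
        have h2 := Finset.add_sum_erase Finset.univ (fun j => κ j i * (B t j + γ j))
          (Finset.mem_univ i)
        have h3 : ∑ j, κ j i * (B t j + γ j) = (κ.transpose.mulVec (B t)) i + d i := by
          rw [← hγ]
          simp [Matrix.mulVec, dotProduct, mul_add, Finset.sum_add_distrib]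
        simp only [Pi.sub_apply, Pi.neg_apply]
        linarith
      · have : Filter.Tendsto (fun t => ∑ j ∈ Finset.univ.erase i, κ j i * (B t j + γ j))
            Filter.atTop (nhds (∑ j ∈ Finset.univ.erase i, (0:ℝ))) := by
          refine tendsto_finsetSum _ fun j hj => ?_
          rcases lt_or_gt_of_ne (Finset.ne_of_mem_erase hj) with h | h
          · simp [hκlow j i h]
          · have h' : i.val < j.val := h
            have := ih (n - 1 - j.val) (by omega) j rfl
            simpa using this.const_mul (κ j i)
        simpa using this.neg
  have hBlim : Filter.Tendsto B Filter.atTop (nhds (fun j => -γ j)) := by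
    rw [tendsto_pi_nhds]
    intro i
    have := (hE _ i rfl).sub_const (γ i)
    simpa using this
  have hQc : Continuous Q := by
    have : Q = fun y => -d₀ + (∑ j, θ j * y j)
        + (1 / 2) * ∑ j, (S.transpose.mulVec y j) ^ 2 := funext hQ
    rw [this]
    simp only [Matrix.mulVec, dotProduct]
    fun_prop
  by_contra hneg
  push Not at hneg
  set q := Q (fun j => -γ j) with hq
  have hev : ∀ᶠ t in Filter.atTop, q / 2 < Q (B t) :=
    ((hQc.tendsto _).comp hBlim).eventually_const_lt (half_lt_self hneg)
  obtain ⟨T0, hT0⟩ := Filter.eventually_atTop.1 hev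
  set T := max T0 0 with hT
  have hTn : 0 ≤ T := le_max_right _ _
  have hBc : ContinuousOn (fun s => Q (B s)) (Set.Ici 0) :=
    hQc.comp_continuousOn fun t ht => (hB t ht).continuousWithinAt
  have hint : ∀ a b : ℝ, 0 ≤ a → a ≤ b →
      IntervalIntegrable (fun s => Q (B s)) MeasureTheory.volume a b := by
    intro a b ha hab
    refine (hBc.mono ?_).intervalIntegrable
    rw [Set.uIcc_of_le hab]
    exact fun t ht => le_trans ha ht.1
  have hle : C (T + 1) ≤ C T := by
    have h := hmono 0 (fun _ => le_rfl) (show T ∈ Set.Ici 0 from hTn)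
      (show T + 1 ∈ Set.Ici 0 from by simp only [Set.mem_Ici]; linarith) (by linarith)
    rw [hP, hP, Real.exp_le_exp] at h
    simpa using h
  have hadd := intervalIntegral.integral_add_adjacent_intervals
    (hint 0 T le_rfl hTn) (hint T (T + 1) hTn (by linarith))
  rw [← hC, ← hC] at hadd
  have hlow : ∫ s in T..(T + 1), q / 2 ≤ ∫ s in T..(T + 1), Q (B s) := by
    refine intervalIntegral.integral_mono_on (by linarith) (by simp)
      (hint T (T + 1) hTn (by linarith)) ?_
    intro t ht
    exact (hT0 t (le_trans (le_max_left _ _) ht.1)).le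
  simp at hlow
  linarith
end

section
/- In the A₀(n) model (n ≥ 2), assume that all off-diagonal entries of κ are nonpositive and that Q(y) ≤ 0 for every y in the vertex set {-γ₁,0} × ⋯ × {-γₙ,0}. Then each component B_j is nonincreasing on [0,∞) with values in [-γ_j, 0], C is nonincreasing on [0,∞), for every x ∈ ℝⁿ with all coordinates positive the map τ ↦ P(x,τ) is strictly decreasing on [0,∞), and for every τ > 0 the map x ↦ P(x,τ) is nonincreasing in each coordinate x_j on the positive orthant. -/
/-- Scalar comparison. -/
lemma aux_scalar (a : ℝ) (f g : ℝ → ℝ)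
    (hf : ∀ t ∈ Set.Ici (0:ℝ), HasDerivWithinAt f (-(a * f t) + g t) (Set.Ici 0) t)
    (hg : ∀ t ∈ Set.Ici (0:ℝ), g t ≤ 0) :
    ∀ t ∈ Set.Ici (0:ℝ), Real.exp (a * t) * f t ≤ f 0 := by
  have hder : ∀ t ∈ Set.Ici (0:ℝ), HasDerivWithinAt (fun t => Real.exp (a * t) * f t)
      (Real.exp (a * t) * g t) (Set.Ici 0) t := by
    intro t ht
    have h1 : HasDerivAt (fun t : ℝ => Real.exp (a * t)) (Real.exp (a * t) * (a * 1)) t :=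
      ((hasDerivAt_id t).const_mul a).exp
    have h2 := h1.hasDerivWithinAt (s := Set.Ici 0) |>.mul (hf t ht)
    refine h2.congr_deriv ?_
    ring
  have hanti : AntitoneOn (fun t => Real.exp (a * t) * f t) (Set.Ici 0) := by
    refine antitoneOn_of_hasDerivWithinAt_nonpos (f' := fun t => Real.exp (a * t) * g t)
      (convex_Ici 0) (fun t ht => (hder t ht).continuousWithinAt) ?_ ?_
    · intro t ht
      exact (hder t (interior_subset ht)).mono interior_subset
    · intro t ht
      exact mul_nonpos_of_nonneg_of_nonpos (Real.exp_pos _).le (hg t (interior_subset ht))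
  intro t ht
  have := hanti (Set.self_mem_Ici) ht ht
  simpa using this

/-- Induction from the top on `Fin n`. -/
lemma aux_ind {n : ℕ} (p : Fin n → Prop) (h : ∀ j, (∀ i, j < i → p i) → p j) : ∀ j, p j := by
  intro j
  induction j using WellFoundedGT.induction with
  | ind j ih => exact h j ih

lemma aux_split {n : ℕ} (κ : Matrix (Fin n) (Fin n) ℝ)
    (hκlow : ∀ i j : Fin n, i < j → κ i j = 0) (w : Fin n → ℝ) (j : Fin n) :
    κ.transpose.mulVec w j = κ j j * w j + ∑ i ∈ Finset.univ.filter (fun i => j < i), κ i j * w i := by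
  classical
  simp only [Matrix.mulVec, dotProduct, Matrix.transpose_apply]
  rw [← Finset.add_sum_erase _ _ (Finset.mem_univ j)]
  congr 1
  symm
  apply Finset.sum_subset
  · intro i hi
    simp at hi ⊢
    exact hi.ne'
  · intro i hi hi'
    simp at hi hi'
    rw [hκlow i j (lt_of_le_of_ne hi' hi), zero_mul]

lemma aux_system {n : ℕ} (κ : Matrix (Fin n) (Fin n) ℝ)
    (hκlow : ∀ i j : Fin n, i < j → κ i j = 0)
    (hκoff : ∀ i j : Fin n, i ≠ j → κ i j ≤ 0)
    (W : ℝ → Fin n → ℝ)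
    (hW : ∀ τ ∈ Set.Ici (0:ℝ), HasDerivWithinAt W (-(κ.transpose.mulVec (W τ))) (Set.Ici 0) τ)
    (hW0 : ∀ j, W 0 j ≤ 0) :
    ∀ j, ∀ t ∈ Set.Ici (0:ℝ), Real.exp (κ j j * t) * W t j ≤ W 0 j := by
  have key : ∀ j, (∀ i, j < i → ∀ t ∈ Set.Ici (0:ℝ), W t i ≤ 0) →
      ∀ t ∈ Set.Ici (0:ℝ), Real.exp (κ j j * t) * W t j ≤ W 0 j := by
    intro j ih
    apply aux_scalar (κ j j) (fun t => W t j)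
      (fun t => - ∑ i ∈ Finset.univ.filter (fun i => j < i), κ i j * W t i)
    · intro t ht
      have := (hasDerivWithinAt_pi.1 (hW t ht)) j
      refine this.congr_deriv ?_
      rw [Pi.neg_apply, aux_split κ hκlow]
      ring
    · intro t ht
      rw [neg_nonpos]
      apply Finset.sum_nonneg
      intro i hi
      simp at hi
      exact mul_nonneg_of_nonpos_of_nonpos (hκoff i j hi.ne') (ih i hi t ht)
  have neg : ∀ j, ∀ t ∈ Set.Ici (0:ℝ), W t j ≤ 0 := by
    apply aux_ind
    intro j ih t ht
    have h1 := (key j ih t ht).trans (hW0 j)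
    by_contra hc
    push Not at hc
    exact absurd h1 (not_le.2 (mul_pos (Real.exp_pos _) hc))
  intro j
  exact key j (fun i _ => neg i)

lemma aux_nonpos {e w z : ℝ} (he : 0 < e) (h : e * w ≤ z) (hz : z ≤ 0) : w ≤ 0 := by
  by_contra hc
  push Not at hc
  nlinarith [mul_pos he hc]

/-- **A₀(n) model, sufficient conditions.**
If all off-diagonal entries of `κ` are nonpositive and `Q ≤ 0` on the vertex set
`{-γ₁,0} × ⋯ × {-γₙ,0}`, then each `B_j` is nonincreasing on `[0,∞)` with values in
`[-γ_j,0]`, `C` is nonincreasing on `[0,∞)`, the bond price is strictly decreasing in `τ`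
for every `x` in the positive orthant, and for every `τ > 0` it is nonincreasing in each
coordinate on the positive orthant. -/
theorem stmt_4 (n : ℕ) (hn : 2 ≤ n)
    (κ : Matrix (Fin n) (Fin n) ℝ)
    (hκlow : ∀ i j : Fin n, i < j → κ i j = 0)
    (hκdiag : ∀ i : Fin n, 0 < κ i i)
    (hκoff : ∀ i j : Fin n, i ≠ j → κ i j ≤ 0)
    (d : Fin n → ℝ) (hd : ∀ j, 0 ≤ d j) (hdn : 0 < d ⟨n - 1, by omega⟩)
    (d₀ : ℝ) (θ : Fin n → ℝ)
    (S : Matrix (Fin n) (Fin n) ℝ) (hS : S.PosDef)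
    (γ : Fin n → ℝ) (hγ : κ.transpose.mulVec γ = d)
    (B : ℝ → Fin n → ℝ) (hB0 : B 0 = 0)
    (hB : ∀ τ ∈ Set.Ici (0:ℝ),
      HasDerivWithinAt B (-(κ.transpose.mulVec (B τ)) - d) (Set.Ici 0) τ)
    (Q : (Fin n → ℝ) → ℝ)
    (hQ : ∀ y, Q y = -d₀ + (∑ j, θ j * y j) + (1 / 2) * ∑ j, (S.transpose.mulVec y j) ^ 2)
    (C : ℝ → ℝ) (hC : ∀ τ, C τ = ∫ s in (0:ℝ)..τ, Q (B s))
    (P : (Fin n → ℝ) → ℝ → ℝ)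
    (hP : ∀ x τ, P x τ = Real.exp ((∑ j, B τ j * x j) + C τ))
    (hQvert : ∀ y : Fin n → ℝ, (∀ j, y j = -γ j ∨ y j = 0) → Q y ≤ 0) :
    (∀ j, AntitoneOn (fun τ => B τ j) (Set.Ici 0)) ∧
    (∀ j, ∀ τ ∈ Set.Ici (0:ℝ), B τ j ∈ Set.Icc (-γ j) 0) ∧
    AntitoneOn C (Set.Ici 0) ∧
    (∀ x : Fin n → ℝ, (∀ j, 0 < x j) → StrictAntiOn (P x) (Set.Ici 0)) ∧
    (∀ τ : ℝ, 0 < τ → ∀ x y : Fin n → ℝ, (∀ j, 0 < x j) → (∀ j, 0 < y j) →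
      (∀ j, x j ≤ y j) → P y τ ≤ P x τ) := by
  classical
  -- γ is nonnegative
  have hγ0 : ∀ j, 0 ≤ γ j := by
    apply aux_ind
    intro j ih
    have h1 := aux_split κ hκlow γ j
    rw [hγ] at h1
    have h2 : ∑ i ∈ Finset.univ.filter (fun i => j < i), κ i j * γ i ≤ 0 := by
      apply Finset.sum_nonpos
      intro i hi
      simp at hi
      exact mul_nonpos_of_nonpos_of_nonneg (hκoff i j hi.ne') (ih i hi)
    have h3 : 0 ≤ κ j j * γ j := by linarith [hd j]
    exact nonneg_of_mul_nonneg_right h3 (hκdiag j)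
  -- lower bound
  have hlow : ∀ j, ∀ t ∈ Set.Ici (0:ℝ), -γ j ≤ B t j := by
    intro j t ht
    have h := aux_system κ hκlow hκoff (fun t => -(B t + γ)) (by
      intro t ht
      refine ((hB t ht).add_const γ).neg.congr_deriv ?_
      rw [Matrix.mulVec_neg, Matrix.mulVec_add, hγ]
      abel) (by
      intro j
      simp [hB0, hγ0 j]) j t ht
    have h2 := aux_nonpos (Real.exp_pos _) h (by simp [hB0, hγ0 j])
    simp at h2
    linarith
  -- derivative
  have hV : ∀ j, ∀ t ∈ Set.Ici (0:ℝ),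
      Real.exp (κ j j * t) * (-(κ.transpose.mulVec (B t)) - d) j ≤ -d j := by
    intro j t ht
    have h := aux_system κ hκlow hκoff (fun t => -(κ.transpose.mulVec (B t)) - d) (by
      intro t ht
      have hL := ((Matrix.mulVecLin κ.transpose).toContinuousLinearMap.hasFDerivAt
        (x := B t)).comp_hasDerivWithinAt t (hB t ht)
      exact (hL.neg.sub_const d)) (by
      intro j
      simp [hB0, hd j]) j t ht
    refine h.trans ?_
    simp [hB0]
  have hBj : ∀ j, ∀ t ∈ Set.Ici (0:ℝ), HasDerivWithinAt (fun t => B t j)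
      ((-(κ.transpose.mulVec (B t)) - d) j) (Set.Ici 0) t :=
    fun j t ht => (hasDerivWithinAt_pi.1 (hB t ht)) j
  have hanti : ∀ j, AntitoneOn (fun τ => B τ j) (Set.Ici 0) := by
    intro j
    refine antitoneOn_of_hasDerivWithinAt_nonpos
      (f' := fun t => (-(κ.transpose.mulVec (B t)) - d) j)
      (convex_Ici 0) (fun t ht => (hBj j t ht).continuousWithinAt) ?_ ?_
    · intro t ht
      exact (hBj j t (interior_subset ht)).mono interior_subset
    · intro t ht
      exact aux_nonpos (Real.exp_pos _) (hV j t (interior_subset ht)) (by linarith [hd j])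
  have hstrict : StrictAntiOn (fun τ => B τ ⟨n - 1, by omega⟩) (Set.Ici 0) := by
    refine strictAntiOn_of_hasDerivWithinAt_neg
      (f' := fun t => (-(κ.transpose.mulVec (B t)) - d) ⟨n - 1, by omega⟩)
      (convex_Ici 0) (fun t ht => (hBj _ t ht).continuousWithinAt) ?_ ?_
    · intro t ht
      exact (hBj _ t (interior_subset ht)).mono interior_subset
    · intro t ht
      have h1 := hV ⟨n - 1, by omega⟩ t (interior_subset ht)
      have h2 := lt_of_le_of_lt h1 (neg_lt_zero.2 hdn)
      exact neg_of_mul_neg_right h2 (Real.exp_pos _).le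
  have hup : ∀ j, ∀ t ∈ Set.Ici (0:ℝ), B t j ≤ 0 := by
    intro j t ht
    have := hanti j Set.self_mem_Ici ht ht
    simpa [hB0] using this
  -- convexity of Q
  have hconv : ConvexOn ℝ Set.univ Q := by
    refine ⟨convex_univ, ?_⟩
    intro x _ y _ a b ha hb hab
    simp only [hQ, Matrix.mulVec_add, Matrix.mulVec_smul, Pi.add_apply, Pi.smul_apply, smul_eq_mul]
    have e1 : ∑ j, θ j * (a * x j + b * y j) = a * ∑ j, θ j * x j + b * ∑ j, θ j * y j := by
      rw [Finset.mul_sum, Finset.mul_sum, ← Finset.sum_add_distrib]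
      exact Finset.sum_congr rfl (fun j _ => by ring)
    have e2 : ∑ j, (a * S.transpose.mulVec x j + b * S.transpose.mulVec y j) ^ 2 ≤
        a * ∑ j, (S.transpose.mulVec x j) ^ 2 + b * ∑ j, (S.transpose.mulVec y j) ^ 2 := by
      rw [Finset.mul_sum, Finset.mul_sum, ← Finset.sum_add_distrib]
      refine Finset.sum_le_sum (fun j _ => ?_)
      have hb' : b = 1 - a := by linarith
      subst hb'
      nlinarith [mul_nonneg (mul_nonneg ha hb)
        (sq_nonneg (S.transpose.mulVec x j - S.transpose.mulVec y j))]
    have e3 : -d₀ = a * (-d₀) + b * (-d₀) := by rw [← add_mul, hab, one_mul]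
    rw [e1]
    linarith
  have hQbox : ∀ y : Fin n → ℝ, (∀ j, y j ∈ Set.Icc (-γ j) 0) → Q y ≤ 0 := by
    intro y hy
    have hmem : y ∈ convexHull ℝ (Set.univ.pi (fun j => ({-γ j, 0} : Set ℝ))) := by
      rw [convexHull_pi]
      intro j _
      beta_reduce
      rw [convexHull_pair, segment_eq_Icc (by linarith [hγ0 j])]
      exact hy j
    obtain ⟨z, hz, hle⟩ := (hconv.subset (Set.subset_univ _)
      (convex_convexHull ℝ _)).exists_ge_of_mem_convexHull (subset_convexHull ℝ _) hmem
    exact hle.trans (hQvert z (fun j => by simpa using hz j (Set.mem_univ j)))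
  have hBc : ContinuousOn B (Set.Ici 0) := fun t ht => (hB t ht).continuousWithinAt
  have hQc : Continuous Q := by
    have : Q = fun y => -d₀ + (∑ j, θ j * y j) + (1 / 2) * ∑ j, (S.transpose.mulVec y j) ^ 2 :=
      funext hQ
    rw [this]
    simp only [Matrix.mulVec, dotProduct]
    fun_prop
  have hQB : ContinuousOn (fun s => Q (B s)) (Set.Ici 0) := hQc.comp_continuousOn hBc
  have hint : ∀ a b : ℝ, 0 ≤ a → 0 ≤ b →
      IntervalIntegrable (fun s => Q (B s)) MeasureTheory.volume a b := by
    intro a b ha hb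
    apply ContinuousOn.intervalIntegrable
    refine hQB.mono (fun t ht => ?_)
    exact le_trans (le_min ha hb) ht.1
  have hCanti : AntitoneOn C (Set.Ici 0) := by
    intro a ha b hb hab
    have h1 := intervalIntegral.integral_add_adjacent_intervals (hint 0 a le_rfl ha) (hint a b ha hb)
    rw [← hC, ← hC] at h1
    have h2 : 0 ≤ ∫ s in a..b, -(Q (B s)) := by
      apply intervalIntegral.integral_nonneg hab
      intro s hs
      have hs0 : s ∈ Set.Ici (0:ℝ) := le_trans ha hs.1
      linarith [hQbox (B s) (fun j => ⟨hlow j s hs0, hup j s hs0⟩)]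
    rw [intervalIntegral.integral_neg] at h2
    linarith
  refine ⟨hanti, fun j τ hτ => ⟨hlow j τ hτ, hup j τ hτ⟩, hCanti, ?_, ?_⟩
  · intro x hx a ha b hb hab
    rw [hP, hP, Real.exp_lt_exp]
    refine add_lt_add_of_lt_of_le ?_ (hCanti ha hb hab.le)
    refine Finset.sum_lt_sum (fun j _ => ?_) ⟨⟨n - 1, by omega⟩, Finset.mem_univ _, ?_⟩
    · exact mul_le_mul_of_nonneg_right (hanti j ha hb hab.le) (hx j).le
    · exact mul_lt_mul_of_pos_right (hstrict ha hb hab) (hx _)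
  · intro τ hτ x y _ _ hxy
    rw [hP, hP, Real.exp_le_exp]
    gcongr ?_ + _
    exact Finset.sum_le_sum (fun j _ => mul_le_mul_of_nonpos_left (hxy j) (hup j τ hτ.le))
end

section
/- In the A₁(2) model, if B₁ is nonincreasing on [0,∞), then both of the following hold: (i) d₁ > 0 or κ₂₁ < 0; (ii) d₁ - κ₂₁γ - (β/2)γ² ≥ 0. -/
/-- **A₁(2) model, necessary conditions for the monotonicity of `B₁`.**
If `B₁` is nonincreasing on `[0,∞)`, then (i) `d₁ > 0` or `κ₂₁ < 0`, and
(ii) `d₁ - κ₂₁γ - (β/2)γ² ≥ 0`. -/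
theorem stmt_5 (κ₁₁ κ₂₂ θ₁ α β κ₂₁ d₀ d₁ d₂ γ : ℝ)
    (hκ₁₁ : 0 < κ₁₁) (hκ₂₂ : 0 < κ₂₂) (hθ₁ : 0 < θ₁) (hα : 0 < α) (hβ : 0 < β)
    (hd₁ : 0 ≤ d₁) (hd₂ : 0 < d₂) (hγ : γ = d₂ / κ₂₂)
    (B₂ : ℝ → ℝ) (hB₂ : ∀ τ, B₂ τ = -γ * (1 - Real.exp (-(κ₂₂ * τ))))
    (B₁ : ℝ → ℝ) (hB₁0 : B₁ 0 = 0)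
    (hB₁ : ∀ τ ∈ Set.Ici (0:ℝ),
      HasDerivWithinAt B₁
        (-(κ₁₁ * B₁ τ) + (1 / 2) * B₁ τ ^ 2 - κ₂₁ * B₂ τ + (β / 2) * B₂ τ ^ 2 - d₁)
        (Set.Ici 0) τ)
    (hmono : AntitoneOn B₁ (Set.Ici 0)) :
    (0 < d₁ ∨ κ₂₁ < 0) ∧ 0 ≤ d₁ - κ₂₁ * γ - (β / 2) * γ ^ 2 := by
  have key : ∀ τ, 0 ≤ τ → -κ₂₁ * B₂ τ + (β / 2) * B₂ τ ^ 2 - d₁ ≤ 0 := by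
    intro τ hτ
    have h1 : derivWithin B₁ (Set.Ici 0) τ ≤ 0 := hmono.derivWithin_nonpos
    rw [(hB₁ τ hτ).derivWithin (uniqueDiffOn_Ici 0 τ hτ)] at h1
    have h2 : B₁ τ ≤ 0 := by
      rw [← hB₁0]
      exact hmono (Set.mem_Ici.2 le_rfl) hτ hτ
    nlinarith [sq_nonneg (B₁ τ), mul_nonneg hκ₁₁.le (neg_nonneg.2 h2)]
  have hγ0 : 0 < γ := by rw [hγ]; positivity
  constructor
  · by_contra hcon
    push Not at hcon
    obtain ⟨h1, h2⟩ := hcon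
    have h3 := key 1 zero_le_one
    have h4 : B₂ 1 < 0 := by
      rw [hB₂]
      have : Real.exp (-(κ₂₂ * 1)) < 1 := by rw [Real.exp_lt_one_iff]; linarith
      nlinarith
    have h5 : 0 < (β / 2) * B₂ 1 ^ 2 := mul_pos (by linarith) (sq_pos_of_neg h4)
    nlinarith [mul_nonneg h2 (neg_nonneg.2 h4.le)]
  · have hlim : Filter.Tendsto B₂ Filter.atTop (nhds (-γ)) := by
      have h1 : Filter.Tendsto (fun τ : ℝ => Real.exp (-(κ₂₂ * τ))) Filter.atTop (nhds 0) :=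
        Real.tendsto_exp_neg_atTop_nhds_zero.comp
          (Filter.tendsto_id.const_mul_atTop hκ₂₂)
      have h2 := (h1.const_sub 1).const_mul (-γ)
      rw [funext hB₂]
      simpa using h2
    have h3 := ((hlim.const_mul (-κ₂₁)).add ((hlim.pow 2).const_mul (β / 2))).sub_const d₁
    have h4 := le_of_tendsto h3 ((Filter.eventually_ge_atTop 0).mono key)
    nlinarith
end

section
/- In the A₁(2) model, if (d₁ > 0 or κ₂₁ < 0) and d₁ - κ₂₁γ - (β/2)γ² ≥ 0, then B₁(τ) < 0 for every τ > 0. -/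
/-- **A₁(2) model, negativity of `B₁`.**
If (`d₁ > 0` or `κ₂₁ < 0`) and `d₁ - κ₂₁γ - (β/2)γ² ≥ 0`, then `B₁ τ < 0` for all `τ > 0`. -/
theorem stmt_6 (κ₁₁ κ₂₂ θ₁ α β κ₂₁ d₀ d₁ d₂ γ : ℝ)
    (hκ₁₁ : 0 < κ₁₁) (hκ₂₂ : 0 < κ₂₂) (hθ₁ : 0 < θ₁) (hα : 0 < α) (hβ : 0 < β)
    (hd₁ : 0 ≤ d₁) (hd₂ : 0 < d₂) (hγ : γ = d₂ / κ₂₂)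
    (B₂ : ℝ → ℝ) (hB₂ : ∀ τ, B₂ τ = -γ * (1 - Real.exp (-(κ₂₂ * τ))))
    (B₁ : ℝ → ℝ) (hB₁0 : B₁ 0 = 0)
    (hB₁ : ∀ τ ∈ Set.Ici (0:ℝ),
      HasDerivWithinAt B₁
        (-(κ₁₁ * B₁ τ) + (1 / 2) * B₁ τ ^ 2 - κ₂₁ * B₂ τ + (β / 2) * B₂ τ ^ 2 - d₁)
        (Set.Ici 0) τ)
    (h1 : 0 < d₁ ∨ κ₂₁ < 0) (h2 : 0 ≤ d₁ - κ₂₁ * γ - (β / 2) * γ ^ 2) :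
    ∀ τ > (0:ℝ), B₁ τ < 0 := by
  intro τ hτ
  have hγ0 : 0 < γ := by rw [hγ]; positivity
  have hcont : ContinuousOn B₁ (Set.Ici 0) := fun t ht => (hB₁ t ht).continuousWithinAt
  have hc : Continuous (fun s : ℝ => B₁ (max s 0)) :=
    hcont.comp_continuous (by fun_prop) (fun s => le_max_right s 0)
  have hF : ∀ t : ℝ, HasDerivAt (fun t : ℝ => ∫ s in (0:ℝ)..t, B₁ (max s 0)) (B₁ (max t 0)) t :=
    fun t => hc.integral_hasStrictDerivAt 0 t |>.hasDerivAt
  set F : ℝ → ℝ := fun t : ℝ => ∫ s in (0:ℝ)..t, B₁ (max s 0) with hFdef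
  have hFc : Continuous F := continuous_iff_continuousAt.2 fun t => (hF t).continuousAt
  have hanti : StrictAntiOn (fun t => B₁ t * Real.exp (κ₁₁ * t - (1 / 2) * F t)) (Set.Ici 0) := by
    apply strictAntiOn_of_deriv_neg (convex_Ici 0)
    · exact hcont.mul (by fun_prop)
    · intro t ht
      rw [interior_Ici] at ht
      have ht' : (0:ℝ) < t := ht
      have hb := (hB₁ t ht'.le).hasDerivAt (Ici_mem_nhds ht')
      have hFt := hF t
      rw [max_eq_left ht'.le] at hFt
      have he := (((hasDerivAt_id t).const_mul κ₁₁).sub (hFt.const_mul (1 / 2))).exp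
      have hp := hb.mul he
      have hd := hp.deriv
      refine lt_of_eq_of_lt hd ?_
      simp only [id, Pi.sub_apply]
      have hE := Real.exp_pos (κ₁₁ * t - 1 / 2 * F t)
      have hx0 := Real.exp_pos (-(κ₂₂ * t))
      have hx1 : Real.exp (-(κ₂₂ * t)) < 1 := by
        rw [Real.exp_lt_one_iff]; nlinarith [mul_pos hκ₂₂ ht']
      have hg : - κ₂₁ * B₂ t + (β / 2) * B₂ t ^ 2 - d₁ < 0 := by
        rw [hB₂]
        generalize Real.exp (-(κ₂₂ * t)) = x at hx0 hx1
        have a1 := mul_nonneg h2 (sub_nonneg.2 hx1.le)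
        have a2 := mul_nonneg hd₁ hx0.le
        have a3 : 0 < β / 2 * γ ^ 2 * (x * (1 - x)) := by
          have := sub_pos.2 hx1
          positivity
        nlinarith
      have := mul_neg_of_neg_of_pos hg hE
      linarith
  have h := hanti (Set.mem_Ici.2 le_rfl) (Set.mem_Ici.2 hτ.le) hτ
  simp only [hB₁0, zero_mul] at h
  exact neg_of_mul_neg_left h (Real.exp_pos _).le
end

section
/- In the A₁(2) model, if (d₁ > 0 or κ₂₁ < 0), d₁ - κ₂₁γ - (β/2)γ² ≥ 0, and βγ + κ₂₁ ≤ 0, then B₁ is strictly decreasing on [0,∞). -/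
/-- **A₁(2) model, sufficient conditions for the decay of `B₁`.**
If (`d₁ > 0` or `κ₂₁ < 0`), `d₁ - κ₂₁γ - (β/2)γ² ≥ 0` and `βγ + κ₂₁ ≤ 0`, then `B₁`
is strictly decreasing on `[0,∞)`. -/
theorem stmt_7 (κ₁₁ κ₂₂ θ₁ α β κ₂₁ d₀ d₁ d₂ γ : ℝ)
    (hκ₁₁ : 0 < κ₁₁) (hκ₂₂ : 0 < κ₂₂) (hθ₁ : 0 < θ₁) (hα : 0 < α) (hβ : 0 < β)
    (hd₁ : 0 ≤ d₁) (hd₂ : 0 < d₂) (hγ : γ = d₂ / κ₂₂)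
    (B₂ : ℝ → ℝ) (hB₂ : ∀ τ, B₂ τ = -γ * (1 - Real.exp (-(κ₂₂ * τ))))
    (B₁ : ℝ → ℝ) (hB₁0 : B₁ 0 = 0)
    (hB₁ : ∀ τ ∈ Set.Ici (0:ℝ),
      HasDerivWithinAt B₁
        (-(κ₁₁ * B₁ τ) + (1 / 2) * B₁ τ ^ 2 - κ₂₁ * B₂ τ + (β / 2) * B₂ τ ^ 2 - d₁)
        (Set.Ici 0) τ)
    (h1 : 0 < d₁ ∨ κ₂₁ < 0) (h2 : 0 ≤ d₁ - κ₂₁ * γ - (β / 2) * γ ^ 2)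
    (h3 : β * γ + κ₂₁ ≤ 0) :
    StrictAntiOn B₁ (Set.Ici 0) := by
  have hγ0 : 0 < γ := by rw [hγ]; positivity
  set D : ℝ → ℝ := fun τ =>
    -(κ₁₁ * B₁ τ) + (1 / 2) * B₁ τ ^ 2 - κ₂₁ * B₂ τ + (β / 2) * B₂ τ ^ 2 - d₁ with hD
  have hB₂d : ∀ τ, HasDerivAt B₂ (-(γ * κ₂₂ * Real.exp (-(κ₂₂ * τ)))) τ := by
    intro τ
    have e : B₂ = fun τ => -γ * (1 - Real.exp (-(κ₂₂ * τ))) := funext hB₂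
    rw [e]
    have h := ((((hasDerivAt_id τ).const_mul κ₂₂).neg.exp).const_sub 1).const_mul (-γ)
    refine h.congr_deriv ?_
    simp
    ring
  have hDd : ∀ τ ∈ Set.Ici (0:ℝ), HasDerivWithinAt D
      ((B₁ τ - κ₁₁) * D τ + (κ₂₁ - β * B₂ τ) * (γ * κ₂₂ * Real.exp (-(κ₂₂ * τ))))
      (Set.Ici 0) τ := by
    intro τ hτ
    have hb := hB₁ τ hτ
    have hc := (hB₂d τ).hasDerivWithinAt (s := Set.Ici 0)
    have h := (((((hb.const_mul κ₁₁).neg.add ((hb.pow 2).const_mul (1/2))).sub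
      (hc.const_mul κ₂₁)).add ((hc.pow 2).const_mul (β/2))).sub_const d₁)
    refine h.congr_deriv ?_
    simp only [hD]
    push_cast
    ring
  have hneg : ∀ τ, (κ₂₁ - β * B₂ τ) * (γ * κ₂₂ * Real.exp (-(κ₂₂ * τ))) < 0 := by
    intro τ
    have he := Real.exp_pos (-(κ₂₂ * τ))
    apply mul_neg_of_neg_of_pos _ (by positivity)
    rw [hB₂]
    have : 0 < β * γ * Real.exp (-(κ₂₂ * τ)) := by positivity
    linarith
  have hD0 : ∀ τ ∈ Set.Ici (0:ℝ), D τ ≤ 0 := by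
    intro T hT
    have hT' : (0:ℝ) ≤ T := hT
    refine image_le_of_deriv_right_lt_deriv_boundary (f := D) (a := 0) (b := T)
      (B := fun _ => 0) (B' := fun _ => 0)
      (fun x hx => ((hDd x hx.1).continuousWithinAt).mono Set.Icc_subset_Ici_self)
      (fun x hx => (hDd x hx.1).mono (Set.Ici_subset_Ici.2 hx.1))
      ?_ (fun x => hasDerivAt_const x 0) ?_ ⟨hT', le_rfl⟩
    · simp [hD, hB₁0, hB₂, hd₁]
    · intro x hx h
      rw [h]
      have := hneg x
      simpa using this
  refine strictAntiOn_of_deriv_neg (convex_Ici 0)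
    (fun x hx => (hB₁ x hx).continuousWithinAt) ?_
  intro x hx
  rw [interior_Ici] at hx
  have hx0 : (0:ℝ) < x := hx
  rw [((hB₁ x hx0.le).hasDerivAt (Ici_mem_nhds hx0)).deriv]
  change D x < 0
  refine lt_of_le_of_ne (hD0 x hx0.le) fun h => ?_
  have hm : IsLocalMax D x := by
    filter_upwards [Ici_mem_nhds hx0] with y hy
    rw [h]
    exact hD0 y hy
  have h' := hm.hasDerivAt_eq_zero ((hDd x hx0.le).hasDerivAt (Ici_mem_nhds hx0))
  rw [h] at h'
  have := hneg x
  linarith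
end

section
/- In the A₁(2) model, if (d₁ > 0 or κ₂₁ < 0), d₁ - κ₂₁γ - (β/2)γ² ≥ 0, βγ + κ₂₁ ≤ 0, and d₀ ≥ (α/2)γ², then C is strictly decreasing on [0,∞); moreover, for every (x₁,x₂) with x₁ > 0 and x₂ > 0, the map τ ↦ P(x,τ) is strictly decreasing on [0,∞), and for every τ > 0 the map x ↦ P(x,τ) is strictly decreasing in x₁ and in x₂. -/
/-- **A₁(2) model, monotonicity of the bond price.**
If (`d₁ > 0` or `κ₂₁ < 0`), `d₁ - κ₂₁γ - (β/2)γ² ≥ 0`, `βγ + κ₂₁ ≤ 0` and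
`d₀ ≥ (α/2)γ²`, then `C` is strictly decreasing on `[0,∞)`; moreover for every
`x₁, x₂ > 0` the bond price `τ ↦ P x₁ x₂ τ` is strictly decreasing on `[0,∞)`, and
for every `τ > 0` the bond price is strictly decreasing in `x₁` and in `x₂` on the
positive orthant. -/
theorem stmt_8 (κ₁₁ κ₂₂ θ₁ α β κ₂₁ d₀ d₁ d₂ γ : ℝ)
    (hκ₁₁ : 0 < κ₁₁) (hκ₂₂ : 0 < κ₂₂) (hθ₁ : 0 < θ₁) (hα : 0 < α) (hβ : 0 < β)
    (hd₁ : 0 ≤ d₁) (hd₂ : 0 < d₂) (hγ : γ = d₂ / κ₂₂)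
    (B₂ : ℝ → ℝ) (hB₂ : ∀ τ, B₂ τ = -γ * (1 - Real.exp (-(κ₂₂ * τ))))
    (B₁ : ℝ → ℝ) (hB₁0 : B₁ 0 = 0)
    (hB₁ : ∀ τ ∈ Set.Ici (0:ℝ),
      HasDerivWithinAt B₁
        (-(κ₁₁ * B₁ τ) + (1 / 2) * B₁ τ ^ 2 - κ₂₁ * B₂ τ + (β / 2) * B₂ τ ^ 2 - d₁)
        (Set.Ici 0) τ)
    (C : ℝ → ℝ)
    (hC : ∀ τ, C τ = ∫ s in (0:ℝ)..τ, (-d₀ + θ₁ * B₁ s + (α / 2) * B₂ s ^ 2))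
    (P : ℝ → ℝ → ℝ → ℝ)
    (hP : ∀ x₁ x₂ τ, P x₁ x₂ τ = Real.exp (B₁ τ * x₁ + B₂ τ * x₂ + C τ))
    (h1 : 0 < d₁ ∨ κ₂₁ < 0) (h2 : 0 ≤ d₁ - κ₂₁ * γ - (β / 2) * γ ^ 2)
    (h3 : β * γ + κ₂₁ ≤ 0) (h4 : (α / 2) * γ ^ 2 ≤ d₀) :
    StrictAntiOn C (Set.Ici 0) ∧
    (∀ x₁ x₂ : ℝ, 0 < x₁ → 0 < x₂ → StrictAntiOn (fun τ => P x₁ x₂ τ) (Set.Ici 0)) ∧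
    (∀ τ : ℝ, 0 < τ →
      (∀ x₂ : ℝ, 0 < x₂ → StrictAntiOn (fun x₁ => P x₁ x₂ τ) (Set.Ioi 0)) ∧
      (∀ x₁ : ℝ, 0 < x₁ → StrictAntiOn (fun x₂ => P x₁ x₂ τ) (Set.Ioi 0))) := by
  have hγ0 : 0 < γ := by rw [hγ]; positivity
  set B : ℝ → ℝ := fun s => B₁ (max s 0) with hBdef
  have hBeq : ∀ s, 0 ≤ s → B s = B₁ s := fun s hs => by simp [hBdef, max_eq_left hs]
  have hB₁c : ContinuousOn B₁ (Set.Ici 0) := fun τ hτ => (hB₁ τ hτ).continuousWithinAt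
  have hBc : Continuous B :=
    hB₁c.comp_continuous (by fun_prop) (fun s => le_max_right s 0)
  have hB₁d : ∀ τ, 0 < τ → HasDerivAt B₁
      (-(κ₁₁ * B₁ τ) + (1 / 2) * B₁ τ ^ 2 - κ₂₁ * B₂ τ + (β / 2) * B₂ τ ^ 2 - d₁) τ :=
    fun τ hτ => (hB₁ τ hτ.le).hasDerivAt (Ici_mem_nhds hτ)
  have hB₂d : ∀ τ, HasDerivAt B₂ (-(γ * κ₂₂ * Real.exp (-(κ₂₂ * τ)))) τ := by
    intro τ
    have h : HasDerivAt (fun τ => -γ * (1 - Real.exp (-(κ₂₂ * τ))))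
        (-γ * (-(Real.exp (-(κ₂₂ * τ)) * (-(κ₂₂ * 1))))) τ :=
      ((((hasDerivAt_id' τ).const_mul κ₂₂).neg.exp).const_sub 1).const_mul (-γ)
    rw [show B₂ = fun τ => -γ * (1 - Real.exp (-(κ₂₂ * τ))) from funext hB₂]
    convert h using 1
    ring
  have hB₂c : Continuous B₂ :=
    continuous_iff_continuousAt.2 fun τ => (hB₂d τ).continuousAt
  have hB₂anti : StrictAnti B₂ := by
    apply strictAnti_of_deriv_neg
    intro τ
    rw [(hB₂d τ).deriv]
    have : 0 < γ * κ₂₂ * Real.exp (-(κ₂₂ * τ)) := by positivity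
    linarith
  have hB₂0 : B₂ 0 = 0 := by simp [hB₂]
  have hB₂neg : ∀ τ, 0 < τ → B₂ τ < 0 := fun τ hτ => by
    have := hB₂anti hτ
    rwa [hB₂0] at this
  have hB₂gt : ∀ τ, -γ < B₂ τ := fun τ => by
    rw [hB₂]
    have : 0 < γ * Real.exp (-(κ₂₂ * τ)) := by positivity
    linarith
  -- the right-hand side
  set u : ℝ → ℝ := fun τ =>
    -(κ₁₁ * B₁ τ) + (1 / 2) * B₁ τ ^ 2 - κ₂₁ * B₂ τ + (β / 2) * B₂ τ ^ 2 - d₁ with hu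
  set G : ℝ → ℝ := fun τ => ∫ s in (0:ℝ)..τ, (κ₁₁ - B s) with hG
  have hGd : ∀ τ, HasDerivAt G (κ₁₁ - B τ) τ := fun τ =>
    (continuous_const.sub hBc).integral_hasStrictDerivAt 0 τ |>.hasDerivAt
  have hGc : Continuous G := continuous_iff_continuousAt.2 fun τ => (hGd τ).continuousAt
  have huc : ContinuousOn u (Set.Ici 0) := by
    have := hB₂c.continuousOn (s := Set.Ici (0:ℝ))
    simp only [hu]
    fun_prop
  have hW : StrictAntiOn (fun τ => u τ * Real.exp (G τ)) (Set.Ici 0) := by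
    apply strictAntiOn_of_deriv_neg (convex_Ici 0)
    · exact huc.mul (Real.continuous_exp.comp hGc).continuousOn
    · intro τ hτ
      rw [interior_Ici] at hτ
      have hτ0 : 0 < τ := hτ
      have hb2 := hB₂d τ
      have hud : HasDerivAt u ((-κ₁₁ + B₁ τ) * u τ +
          (-κ₂₁ + β * B₂ τ) * (-(γ * κ₂₂ * Real.exp (-(κ₂₂ * τ))))) τ := by
        have hb1 : HasDerivAt B₁ (u τ) τ := hB₁d τ hτ0
        have h := (((((hb1.const_mul κ₁₁).neg.add ((hb1.pow 2).const_mul (1/2))).sub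
          (hb2.const_mul κ₂₁)).add ((hb2.pow 2).const_mul (β/2))).sub_const d₁)
        refine HasDerivAt.congr_deriv (f := u) h ?_
        simp
        ring
      have hd := hud.mul (hGd τ).exp
      have hd' : deriv (fun τ => u τ * Real.exp (G τ)) τ = _ := hd.deriv
      rw [hd', hBeq τ hτ0.le]
      have e1 : 0 < -κ₂₁ + β * B₂ τ := by nlinarith [hB₂gt τ]
      have e2 : 0 < (-κ₂₁ + β * B₂ τ) * (γ * κ₂₂ * Real.exp (-(κ₂₂ * τ))) * Real.exp (G τ) := by
        positivity
      linarith
  have huneg : ∀ τ, 0 < τ → u τ < 0 := by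
    intro τ hτ
    have h := hW (Set.self_mem_Ici) (Set.mem_Ici.2 hτ.le) hτ
    have h0 : u 0 = -d₁ := by simp [hu, hB₁0, hB₂0]
    have hG0 : G 0 = 0 := by simp [hG]
    simp only [h0, hG0, Real.exp_zero] at h
    have := Real.exp_pos (G τ)
    by_contra hc
    push Not at hc
    have := mul_nonneg hc this.le
    linarith
  have hB₁anti : StrictAntiOn B₁ (Set.Ici 0) := by
    apply strictAntiOn_of_deriv_neg (convex_Ici 0) hB₁c
    intro τ hτ
    rw [interior_Ici] at hτ
    rw [(hB₁d τ hτ).deriv]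
    exact huneg τ hτ
  have hB₁neg : ∀ τ, 0 < τ → B₁ τ < 0 := fun τ hτ => by
    have := hB₁anti Set.self_mem_Ici (Set.mem_Ici.2 hτ.le) hτ
    rwa [hB₁0] at this
  set D : ℝ → ℝ := fun τ => ∫ s in (0:ℝ)..τ, (-d₀ + θ₁ * B s + (α / 2) * B₂ s ^ 2) with hD
  have hDd : ∀ τ, HasDerivAt D (-d₀ + θ₁ * B τ + (α / 2) * B₂ τ ^ 2) τ := fun τ =>
    (show Continuous (fun s => -d₀ + θ₁ * B s + (α / 2) * B₂ s ^ 2) by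
      fun_prop).integral_hasStrictDerivAt 0 τ |>.hasDerivAt
  have hDanti : StrictAntiOn D (Set.Ici 0) := by
    apply strictAntiOn_of_deriv_neg (convex_Ici 0)
    · exact fun τ _ => (hDd τ).continuousAt.continuousWithinAt
    · intro τ hτ
      rw [interior_Ici] at hτ
      have hτ0 : 0 < τ := hτ
      rw [(hDd τ).deriv, hBeq τ hτ0.le]
      have e1 : θ₁ * B₁ τ < 0 := mul_neg_of_pos_of_neg hθ₁ (hB₁neg τ hτ0)
      have e2 : B₂ τ ^ 2 ≤ γ ^ 2 := by nlinarith [hB₂gt τ, hB₂neg τ hτ0]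
      have e3 : α / 2 * B₂ τ ^ 2 ≤ α / 2 * γ ^ 2 := by gcongr
      linarith
  have hCD : ∀ τ ∈ Set.Ici (0:ℝ), D τ = C τ := by
    intro τ hτ
    rw [hC]
    apply intervalIntegral.integral_congr
    intro s hs
    rw [Set.uIcc_of_le hτ] at hs
    simp only [hBeq s hs.1]
  have hCanti : StrictAntiOn C (Set.Ici 0) := hDanti.congr hCD
  refine ⟨hCanti, ?_, ?_⟩
  · intro x₁ x₂ hx₁ hx₂ a ha b hb hab
    simp only [hP]
    apply Real.exp_lt_exp.2
    have e1 := mul_lt_mul_of_pos_right (hB₁anti ha hb hab) hx₁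
    have e2 := mul_lt_mul_of_pos_right (hB₂anti hab) hx₂
    have e3 := hCanti ha hb hab
    linarith
  · intro τ hτ
    constructor
    · intro x₂ _ a _ b _ hab
      simp only [hP]
      apply Real.exp_lt_exp.2
      have := mul_lt_mul_of_neg_left hab (hB₁neg τ hτ)
      linarith
    · intro x₁ _ a _ b _ hab
      simp only [hP]
      apply Real.exp_lt_exp.2
      have := mul_lt_mul_of_neg_left hab (hB₂neg τ hτ)
      linarith
end

section
/- In the A₁(n) model, for every j = 2,…,n the function B_j is continuous and nonincreasing on [0,∞), B_j(0) = 0, B_j(τ) → -γ_j as τ → ∞, and -γ_j ≤ B_j(τ) ≤ 0 for all τ ≥ 0. -/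
lemma comp_lower (k : ℝ) (f g : ℝ → ℝ)
    (hf : ∀ t ∈ Set.Ici (0:ℝ), HasDerivWithinAt f (-k * f t + g t) (Set.Ici 0) t)
    (a b c : ℝ) (ha : 0 ≤ a) (hab : a ≤ b) (hg : ∀ s, a ≤ s → s ≤ b → k * c ≤ g s) :
    Real.exp (k * a) * (f a - c) ≤ Real.exp (k * b) * (f b - c) := by
  have hexp : ∀ s, HasDerivAt (fun s => Real.exp (k * s)) (Real.exp (k * s) * k) s := by
    intro s
    simpa using ((hasDerivAt_id s).const_mul k).exp
  have hmono : MonotoneOn (fun s => Real.exp (k * s) * (f s - c)) (Set.Icc a b) := by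
    apply monotoneOn_of_hasDerivWithinAt_nonneg (convex_Icc a b)
      (f' := fun s => Real.exp (k * s) * k * (f s - c) + Real.exp (k * s) * (-k * f s + g s))
    · intro s hs
      have h1 := (hf s (le_trans ha hs.1)).continuousWithinAt
      have h2 : ContinuousWithinAt f (Set.Icc a b) s := h1.mono (fun x hx => le_trans ha hx.1)
      exact (hexp s).continuousAt.continuousWithinAt.mul (h2.sub continuousWithinAt_const)
    · intro s hs
      rw [interior_Icc] at hs
      have h1 := (hf s (le_trans ha hs.1.le)).mono
        (s := interior (Set.Icc a b)) (fun x hx => le_trans ha (interior_subset (s := Set.Icc a b) hx).1)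
      exact (hexp s).hasDerivWithinAt.mul (h1.sub_const c)
    · intro s hs
      rw [interior_Icc] at hs
      have h := hg s hs.1.le hs.2.le
      have e := Real.exp_pos (k * s)
      have : Real.exp (k * s) * k * (f s - c) + Real.exp (k * s) * (-k * f s + g s)
        = Real.exp (k * s) * (g s - k * c) := by ring
      rw [this]
      exact mul_nonneg e.le (by linarith)
  exact hmono ⟨le_rfl, hab⟩ ⟨hab, le_rfl⟩ hab

lemma scalar_ode (k γ : ℝ) (hk : 0 < k) (f g : ℝ → ℝ)
    (hf : ∀ t ∈ Set.Ici (0:ℝ), HasDerivWithinAt f (-k * f t + g t) (Set.Ici 0) t)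
    (hf0 : f 0 = 0) (hg0 : g 0 ≤ 0) (hg : AntitoneOn g (Set.Ici 0))
    (hlim : Filter.Tendsto g Filter.atTop (nhds (-(k * γ))))
    (hlow : ∀ t ∈ Set.Ici (0:ℝ), -(k * γ) ≤ g t) :
    AntitoneOn f (Set.Ici 0) ∧ Filter.Tendsto f Filter.atTop (nhds (-γ)) ∧
    ∀ t ∈ Set.Ici (0:ℝ), f t ∈ Set.Icc (-γ) 0 := by
  have hγ : 0 ≤ γ := by
    have := hlow 0 (Set.mem_Ici.2 le_rfl)
    nlinarith
  have key : ∀ t ∈ Set.Ici (0:ℝ), -k * f t + g t ≤ 0 := by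
    intro t ht
    have h := comp_lower k f g hf 0 t (g t / k) le_rfl ht (by
      intro s hs hst
      rw [mul_div_cancel₀ _ hk.ne']
      exact hg hs ht hst)
    have hgt : g t ≤ 0 := (hg (Set.mem_Ici.2 le_rfl) ht ht).trans hg0
    have h3 : g t / k ≤ 0 := div_nonpos_of_nonpos_of_nonneg hgt hk.le
    rw [hf0] at h
    simp only [mul_zero, Real.exp_zero, one_mul] at h
    have h2 : 0 ≤ f t - g t / k := by
      by_contra hn
      push Not at hn
      have := mul_neg_of_pos_of_neg (Real.exp_pos (k * t)) hn
      linarith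
    have h4 : k * (g t / k) = g t := mul_div_cancel₀ _ hk.ne'
    nlinarith
  have hanti : AntitoneOn f (Set.Ici 0) := by
    apply antitoneOn_of_hasDerivWithinAt_nonpos (convex_Ici 0)
      (fun t ht => (hf t ht).continuousWithinAt) (f' := fun t => -k * f t + g t)
    · intro t ht
      exact (hf t (interior_subset ht)).mono interior_subset
    · intro t ht
      exact key t (interior_subset ht)
  have hlb : ∀ t ∈ Set.Ici (0:ℝ), -γ ≤ f t := by
    intro t ht
    have := hlow t ht
    have := key t ht
    nlinarith
  refine ⟨hanti, ?_, fun t ht => ⟨hlb t ht, ?_⟩⟩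
  · rw [tendsto_order]
    constructor
    · intro a ha
      filter_upwards [Filter.eventually_ge_atTop 0] with t ht
      exact lt_of_lt_of_le ha (hlb t ht)
    · intro a ha
      set e := (a + γ) / 2 with he
      have hepos : 0 < e := by rw [he]; linarith
      have h1 : ∀ᶠ t in Filter.atTop, g t < -(k * γ) + k * e :=
        hlim.eventually_lt_const (by nlinarith)
      obtain ⟨T, hT⟩ := Filter.eventually_atTop.1 h1
      have h2 : ∀ t, max T 0 ≤ t → Real.exp (k * t) * (f t - (-γ + e)) ≤
          Real.exp (k * max T 0) * (f (max T 0) - (-γ + e)) := by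
        intro t ht
        have h := comp_lower k (fun s => - f s) (fun s => - g s) (by
          intro s hs
          exact (hf s hs).neg.congr_deriv (by ring)) (max T 0) t (γ - e) (le_max_right _ _) ht (by
          intro s hs _
          have := hT s ((le_max_left _ _).trans hs)
          nlinarith)
        nlinarith
      set C := Real.exp (k * max T 0) * (f (max T 0) - (-γ + e)) with hC
      have h3 : Filter.Tendsto (fun t => Real.exp (k * t) * e) Filter.atTop Filter.atTop :=
        (Real.tendsto_exp_atTop.comp (Filter.tendsto_id.const_mul_atTop hk)).atTop_mul_const hepos
      filter_upwards [h3.eventually_gt_atTop C, Filter.eventually_ge_atTop (max T 0)] with t ht1 ht2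
      have h4 := lt_of_le_of_lt (h2 t ht2) ht1
      have h5 := lt_of_mul_lt_mul_left h4 (Real.exp_pos _).le
      linarith
  · have := hanti (Set.mem_Ici.2 le_rfl) ht ht
    rwa [hf0] at this

theorem stmt_9 (m : ℕ) (hm : 1 ≤ m)
    (κt : Matrix (Fin m) (Fin m) ℝ)
    (hκlow : ∀ i j : Fin m, i < j → κt i j = 0)
    (hκdiag : ∀ i : Fin m, 0 < κt i i)
    (hκoff : ∀ i j : Fin m, j < i → κt i j ≤ 0)
    (d2 : Fin m → ℝ) (hd2 : ∀ j, 0 ≤ d2 j) (hdn : 0 < d2 ⟨m - 1, by omega⟩)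
    (γt : Fin m → ℝ) (hγt : κt.transpose.mulVec γt = d2)
    (ℬ : ℝ → Fin m → ℝ) (hℬ0 : ℬ 0 = 0)
    (hℬ : ∀ τ ∈ Set.Ici (0:ℝ),
      HasDerivWithinAt ℬ (-(κt.transpose.mulVec (ℬ τ)) - d2) (Set.Ici 0) τ) :
    ∀ j : Fin m,
      ContinuousOn (fun τ => ℬ τ j) (Set.Ici 0) ∧
      AntitoneOn (fun τ => ℬ τ j) (Set.Ici 0) ∧
      ℬ 0 j = 0 ∧
      Filter.Tendsto (fun τ => ℬ τ j) Filter.atTop (nhds (-γt j)) ∧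
      ∀ τ ∈ Set.Ici (0:ℝ), ℬ τ j ∈ Set.Icc (-γt j) 0 := by
  have hsum : ∀ (j : Fin m) (v : Fin m → ℝ), κt.transpose.mulVec v j =
      κt j j * v j + ∑ i ∈ Finset.Ioi j, κt i j * v i := by
    intro j v
    have h1 : κt.transpose.mulVec v j = ∑ i, κt i j * v i := rfl
    rw [h1, ← Finset.sum_subset (Finset.subset_univ (Finset.Ici j))]
    · rw [← Finset.Ioi_insert, Finset.sum_insert (by simp)]
    · intro i _ hi
      rw [hκlow i j (by simpa using hi), zero_mul]
  have main : ∀ j : Fin m, AntitoneOn (fun τ => ℬ τ j) (Set.Ici 0) ∧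
      Filter.Tendsto (fun τ => ℬ τ j) Filter.atTop (nhds (-γt j)) ∧
      ∀ τ ∈ Set.Ici (0:ℝ), ℬ τ j ∈ Set.Icc (-γt j) 0 := by
    intro j
    induction j using WellFoundedGT.induction with
    | ind j ih =>
    have hγj : κt j j * γt j = d2 j - ∑ i ∈ Finset.Ioi j, κt i j * γt i := by
      rw [← hγt, hsum j γt]; ring
    have hval : -(κt j j * γt j) = -(∑ i ∈ Finset.Ioi j, κt i j * (-γt i)) - d2 j := by
      rw [hγj]; simp only [mul_neg, Finset.sum_neg_distrib]; ring
    apply scalar_ode (κt j j) (γt j) (hκdiag j) (fun τ => ℬ τ j)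
      (fun τ => -(∑ i ∈ Finset.Ioi j, κt i j * ℬ τ i) - d2 j)
    · intro t ht
      refine ((hasDerivWithinAt_pi.1 (hℬ t ht)) j).congr_deriv ?_
      simp only [Pi.sub_apply, Pi.neg_apply, hsum]
      ring
    · simp [hℬ0]
    · simp [hℬ0, hd2 j]
    · intro s hs t ht hst
      have : ∑ i ∈ Finset.Ioi j, κt i j * ℬ s i ≤ ∑ i ∈ Finset.Ioi j, κt i j * ℬ t i :=
        Finset.sum_le_sum fun i hi =>
          mul_le_mul_of_nonpos_left ((ih i (Finset.mem_Ioi.1 hi)).1 hs ht hst)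
            (hκoff i j (Finset.mem_Ioi.1 hi))
      show -(∑ i ∈ Finset.Ioi j, κt i j * ℬ t i) - d2 j ≤
        -(∑ i ∈ Finset.Ioi j, κt i j * ℬ s i) - d2 j
      linarith
    · rw [hval]
      exact ((tendsto_finsetSum _ fun i hi =>
        ((ih i (Finset.mem_Ioi.1 hi)).2.1).const_mul _).neg).sub_const _
    · intro t ht
      rw [hval]
      have : ∑ i ∈ Finset.Ioi j, κt i j * ℬ t i ≤ ∑ i ∈ Finset.Ioi j, κt i j * (-γt i) :=
        Finset.sum_le_sum fun i hi =>
          mul_le_mul_of_nonpos_left ((ih i (Finset.mem_Ioi.1 hi)).2.2 t ht).1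
            (hκoff i j (Finset.mem_Ioi.1 hi))
      linarith
  intro j
  refine ⟨fun t ht => ((hasDerivWithinAt_pi.1 (hℬ t ht)) j).continuousWithinAt,
    (main j).1, by simp [hℬ0], (main j).2.1, (main j).2.2⟩
end

section
/- In the A₂(3) model, assume that for each j = 1, 2: (i) d_j > 0, or d_j = 0 and κ_{3j} < 0; (ii) d_j - κ_{3j}γ - (β_{3j}/2)γ² ≥ 0; (iii) κ_{3j} + β_{3j}γ ≤ 0; (iv) β_{3j} > 0 or κ_{3j} < 0. Then B₁ and B₂ are strictly decreasing on [0,∞). -/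
open Set Filter Topology in
lemma step_right (u : ℝ → ℝ) (c t : ℝ) (ht : 0 ≤ t) (hu : HasDerivWithinAt u c (Ici 0) t)
    (hle : u t ≤ 0) (h : u t = 0 → c < 0) : ∀ᶠ z in 𝓝[>] t, u z ≤ 0 := by
  have hu' : HasDerivWithinAt u c (Ioi t) t :=
    hu.mono (fun x hx => le_trans ht (le_of_lt hx))
  rcases hle.lt_or_eq with h0 | h0
  · have := hu'.continuousWithinAt.tendsto.eventually (gt_mem_nhds h0)
    exact this.mono fun z hz => le_of_lt hz
  · have hs := (hasDerivWithinAt_iff_tendsto_slope' (by simp)).1 hu'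
    filter_upwards [hs.eventually (gt_mem_nhds (h h0)), self_mem_nhdsWithin] with z hz hzt
    rw [slope_def_field, h0, sub_zero] at hz
    have hzt' : 0 < z - t := sub_pos.2 hzt
    have := (div_lt_iff₀ hzt').1 hz
    linarith

open Set Filter Topology in
lemma step_left (u : ℝ → ℝ) (c t : ℝ) (ht : 0 < t) (hu : HasDerivWithinAt u c (Ici 0) t)
    (hle : ∀ s, 0 ≤ s → u s ≤ 0) (h : u t = 0 → c < 0) : u t < 0 := by
  rcases (hle t ht.le).lt_or_eq with h0 | h0
  · exact h0
  exfalso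
  have hu' : HasDerivWithinAt u c (Iio t) t :=
    (hu.hasDerivAt (Ici_mem_nhds ht)).hasDerivWithinAt
  have hs := (hasDerivWithinAt_iff_tendsto_slope' (by simp)).1 hu'
  have hpos : ∀ᶠ z in 𝓝[<] t, 0 < z := mem_nhdsWithin_of_mem_nhds (Ioi_mem_nhds ht)
  have hlt : ∀ᶠ z in 𝓝[<] t, z < t := self_mem_nhdsWithin
  obtain ⟨z, hz, hzt, hz0⟩ := ((hs.eventually (gt_mem_nhds (h h0))).and
    (hlt.and hpos)).exists
  rw [slope_def_field, h0, sub_zero] at hz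
  have hzt' : z - t < 0 := sub_neg.2 hzt
  have := (div_lt_iff_of_neg hzt').1 hz
  linarith [hle z hz0.le]

open Set Filter Topology in
lemma key_neg (u v u' v' : ℝ → ℝ)
    (hu : ∀ t, 0 ≤ t → HasDerivWithinAt u (u' t) (Ici 0) t)
    (hv : ∀ t, 0 ≤ t → HasDerivWithinAt v (v' t) (Ici 0) t)
    (h1 : ∀ t, 0 ≤ t → v t ≤ 0 → u t = 0 → u' t < 0)
    (h2 : ∀ t, 0 ≤ t → u t ≤ 0 → v t = 0 → v' t < 0)
    (hu0 : u 0 ≤ 0) (hv0 : v 0 ≤ 0) : ∀ t, 0 < t → u t < 0 ∧ v t < 0 := by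
  have hcu : ContinuousOn u (Ici 0) := fun t ht => (hu t ht).continuousWithinAt
  have hcv : ContinuousOn v (Ici 0) := fun t ht => (hv t ht).continuousWithinAt
  have hall : ∀ b, 0 ≤ b → u b ≤ 0 ∧ v b ≤ 0 := by
    intro b hb
    have hsub : Icc (0:ℝ) b ⊆ Ici 0 := fun x hx => hx.1
    have hcl : IsClosed ({t | u t ≤ 0 ∧ v t ≤ 0} ∩ Icc 0 b) := by
      have e : {t | u t ≤ 0 ∧ v t ≤ 0} ∩ Icc 0 b
          = (Icc 0 b ∩ u ⁻¹' Iic 0) ∩ (Icc 0 b ∩ v ⁻¹' Iic 0) := by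
        ext x; simp only [mem_inter_iff, mem_ofPred_eq, mem_preimage, mem_Iic]; tauto
      rw [e]
      exact ((hcu.mono hsub).preimage_isClosed_of_isClosed isClosed_Icc isClosed_Iic).inter
        ((hcv.mono hsub).preimage_isClosed_of_isClosed isClosed_Icc isClosed_Iic)
    refine hcl.Icc_subset_of_forall_exists_gt ⟨hu0, hv0⟩ ?_ (right_mem_Icc.2 hb)
    rintro x ⟨⟨hx1, hx2⟩, hx⟩ y hy
    have e1 := step_right u _ x hx.1 (hu x hx.1) hx1 (h1 x hx.1 hx2)
    have e2 := step_right v _ x hx.1 (hv x hx.1) hx2 (h2 x hx.1 hx1)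
    have e3 : ∀ᶠ z in 𝓝[>] x, z ∈ Ioc x y := Ioc_mem_nhdsGT hy
    obtain ⟨z, a, b, c⟩ := (e1.and (e2.and e3)).exists
    exact ⟨z, ⟨a, b⟩, c⟩
  intro t ht
  exact ⟨step_left u _ t ht (hu t ht.le) (fun s hs => (hall s hs).1) (h1 t ht.le (hall t ht.le).2),
    step_left v _ t ht (hv t ht.le) (fun s hs => (hall s hs).2) (h2 t ht.le (hall t ht.le).1)⟩

lemma forcing_neg (κ β γ b e : ℝ) (hβ : 0 ≤ β) (h3 : κ + β * γ ≤ 0) (h4 : 0 < β ∨ κ < 0)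
    (hb : -γ < b) (he : e < 0) : (-κ + β * b) * e < 0 := by
  refine mul_neg_of_pos_of_neg ?_ he
  rcases hβ.lt_or_eq with h | h
  · nlinarith
  · subst h
    rcases h4 with h4 | h4 <;> linarith

/-- **A₂(3) model, sufficient conditions for the decay of `B₁`, `B₂`.**
If for each `j = 1,2`: (i) `d_j > 0`, or `d_j = 0` and `κ_{3j} < 0`;
(ii) `d_j - κ_{3j}γ - (β_{3j}/2)γ² ≥ 0`; (iii) `κ_{3j} + β_{3j}γ ≤ 0`;
(iv) `β_{3j} > 0` or `κ_{3j} < 0`, then `B₁` and `B₂` are strictly decreasing on `[0,∞)`. -/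
theorem stmt_14 (θ₁ θ₂ κ₁₁ κ₂₂ κ₃₃ κ₂₁ κ₁₂ κ₃₁ κ₃₂ α₃ β₁₁ β₂₂ β₃₁ β₃₂ d₀ d₁ d₂ d₃ γ : ℝ)
    (hθ₁ : 0 < θ₁) (hθ₂ : 0 < θ₂)
    (hκ₁₁ : 0 < κ₁₁) (hκ₂₂ : 0 < κ₂₂) (hκ₃₃ : 0 < κ₃₃)
    (hκ₂₁ : κ₂₁ ≤ 0) (hκ₁₂ : κ₁₂ ≤ 0) (hΔpos : 0 < κ₁₁ * κ₂₂ - κ₁₂ * κ₂₁)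
    (hα₃ : 0 < α₃) (hβ₁₁ : 0 < β₁₁) (hβ₂₂ : 0 < β₂₂)
    (hβ₃₁ : 0 ≤ β₃₁) (hβ₃₂ : 0 ≤ β₃₂)
    (hd₁ : 0 ≤ d₁) (hd₂ : 0 ≤ d₂) (hd₃ : 0 < d₃) (hγ : γ = d₃ / κ₃₃)
    (B₃ : ℝ → ℝ) (hB₃ : ∀ τ, B₃ τ = -γ * (1 - Real.exp (-(κ₃₃ * τ))))
    (B₁ B₂ : ℝ → ℝ) (hB₁0 : B₁ 0 = 0) (hB₂0 : B₂ 0 = 0)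
    (hB₁ : ∀ τ ∈ Set.Ici (0:ℝ),
      HasDerivWithinAt B₁
        (-(κ₁₁ * B₁ τ) - κ₂₁ * B₂ τ + (β₁₁ / 2) * B₁ τ ^ 2 - d₁
          - κ₃₁ * B₃ τ + (β₃₁ / 2) * B₃ τ ^ 2) (Set.Ici 0) τ)
    (hB₂ : ∀ τ ∈ Set.Ici (0:ℝ),
      HasDerivWithinAt B₂
        (-(κ₁₂ * B₁ τ) - κ₂₂ * B₂ τ + (β₂₂ / 2) * B₂ τ ^ 2 - d₂
          - κ₃₂ * B₃ τ + (β₃₂ / 2) * B₃ τ ^ 2) (Set.Ici 0) τ)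
    (h11 : 0 < d₁ ∨ (d₁ = 0 ∧ κ₃₁ < 0)) (h12 : 0 < d₂ ∨ (d₂ = 0 ∧ κ₃₂ < 0))
    (h21 : 0 ≤ d₁ - κ₃₁ * γ - (β₃₁ / 2) * γ ^ 2)
    (h22 : 0 ≤ d₂ - κ₃₂ * γ - (β₃₂ / 2) * γ ^ 2)
    (h31 : κ₃₁ + β₃₁ * γ ≤ 0) (h32 : κ₃₂ + β₃₂ * γ ≤ 0)
    (h41 : 0 < β₃₁ ∨ κ₃₁ < 0) (h42 : 0 < β₃₂ ∨ κ₃₂ < 0) :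
    StrictAntiOn B₁ (Set.Ici 0) ∧ StrictAntiOn B₂ (Set.Ici 0) := by
  have hγ0 : 0 < γ := by rw [hγ]; positivity
  have hB₃d : ∀ τ, HasDerivWithinAt B₃ (-(γ * κ₃₃ * Real.exp (-(κ₃₃ * τ)))) (Set.Ici 0) τ := by
    intro τ
    have e : B₃ = fun τ => -γ * (1 - Real.exp (-(κ₃₃ * τ))) := funext hB₃
    rw [e]
    have h := (((((hasDerivAt_id τ).const_mul κ₃₃).neg).exp.const_sub 1).const_mul (-γ))
    refine (h.congr_deriv ?_).hasDerivWithinAt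
    simp
    ring
  have hB₃l : ∀ τ, -γ < B₃ τ := by
    intro τ
    rw [hB₃]
    nlinarith [mul_pos hγ0 (Real.exp_pos (-(κ₃₃ * τ)))]
  have hB₃n : ∀ τ, -(γ * κ₃₃ * Real.exp (-(κ₃₃ * τ))) < 0 := by
    intro τ
    have := mul_pos (mul_pos hγ0 hκ₃₃) (Real.exp_pos (-(κ₃₃ * τ)))
    linarith
  have hB₃0 : B₃ 0 = 0 := by rw [hB₃]; simp
  have hf₁ := fun τ => forcing_neg κ₃₁ β₃₁ γ _ _ hβ₃₁ h31 h41 (hB₃l τ) (hB₃n τ)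
  have hf₂ := fun τ => forcing_neg κ₃₂ β₃₂ γ _ _ hβ₃₂ h32 h42 (hB₃l τ) (hB₃n τ)
  set D : ℝ → ℝ := fun τ => -(γ * κ₃₃ * Real.exp (-(κ₃₃ * τ))) with hD
  set u : ℝ → ℝ := fun τ => -(κ₁₁ * B₁ τ) - κ₂₁ * B₂ τ + (β₁₁ / 2) * B₁ τ ^ 2 - d₁
          - κ₃₁ * B₃ τ + (β₃₁ / 2) * B₃ τ ^ 2 with hu
  set v : ℝ → ℝ := fun τ => -(κ₁₂ * B₁ τ) - κ₂₂ * B₂ τ + (β₂₂ / 2) * B₂ τ ^ 2 - d₂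
          - κ₃₂ * B₃ τ + (β₃₂ / 2) * B₃ τ ^ 2 with hv
  have hB₁' : ∀ τ, 0 ≤ τ → HasDerivWithinAt B₁ (u τ) (Set.Ici 0) τ := fun τ h => hB₁ τ h
  have hB₂' : ∀ τ, 0 ≤ τ → HasDerivWithinAt B₂ (v τ) (Set.Ici 0) τ := fun τ h => hB₂ τ h
  have hB₃' : ∀ τ, HasDerivWithinAt B₃ (D τ) (Set.Ici 0) τ := hB₃d
  have hneg := key_neg u v
    (fun τ => (-κ₁₁ + β₁₁ * B₁ τ) * u τ - κ₂₁ * v τ + (-κ₃₁ + β₃₁ * B₃ τ) * D τ)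
    (fun τ => (-κ₂₂ + β₂₂ * B₂ τ) * v τ - κ₁₂ * u τ + (-κ₃₂ + β₃₂ * B₃ τ) * D τ)
    (by
      intro t ht
      have a := hB₁' t ht
      have b := hB₂' t ht
      have c := hB₃' t
      have h := ((((((a.const_mul κ₁₁).neg).sub (b.const_mul κ₂₁)).add
        ((a.pow 2).const_mul (β₁₁ / 2))).sub_const d₁).sub (c.const_mul κ₃₁)).add
        ((c.pow 2).const_mul (β₃₁ / 2))
      refine h.congr_deriv ?_
      generalize u t = x
      generalize v t = y
      generalize D t = z
      simp
      ring)
    (by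
      intro t ht
      have a := hB₁' t ht
      have b := hB₂' t ht
      have c := hB₃' t
      have h := ((((((a.const_mul κ₁₂).neg).sub (b.const_mul κ₂₂)).add
        ((b.pow 2).const_mul (β₂₂ / 2))).sub_const d₂).sub (c.const_mul κ₃₂)).add
        ((c.pow 2).const_mul (β₃₂ / 2))
      refine h.congr_deriv ?_
      generalize u t = x
      generalize v t = y
      generalize D t = z
      simp
      ring)
    (by
      intro t ht hvt hut
      have h1 := hf₁ t
      have h2 := mul_nonneg_of_nonpos_of_nonpos hκ₂₁ hvt
      change _ * D t < 0 at h1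
      change _ * u t - _ * v t + _ < 0
      rw [hut]
      linarith)
    (by
      intro t ht hut hvt
      have h1 := hf₂ t
      have h2 := mul_nonneg_of_nonpos_of_nonpos hκ₁₂ hut
      change _ * D t < 0 at h1
      change _ * v t - _ * u t + _ < 0
      rw [hvt]
      linarith)
    (by simp [hu, hB₁0, hB₂0, hB₃0, hd₁])
    (by simp [hv, hB₁0, hB₂0, hB₃0, hd₂])
  constructor
  · refine strictAntiOn_of_deriv_neg (convex_Ici 0)
      (fun t ht => (hB₁' t ht).continuousWithinAt) ?_
    intro t ht
    rw [interior_Ici] at ht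
    rw [((hB₁' t (le_of_lt ht)).hasDerivAt (Ici_mem_nhds ht)).deriv]
    exact (hneg t ht).1
  · refine strictAntiOn_of_deriv_neg (convex_Ici 0)
      (fun t ht => (hB₂' t ht).continuousWithinAt) ?_
    intro t ht
    rw [interior_Ici] at ht
    rw [((hB₂' t (le_of_lt ht)).hasDerivAt (Ici_mem_nhds ht)).deriv]
    exact (hneg t ht).2
end

section
/- In the A₂(3) model, assume that for each j = 1, 2: (i) d_j > 0, or d_j = 0 and κ_{3j} < 0; and (ii) d_j - κ_{3j}γ - (β_{3j}/2)γ² ≥ 0. Then B₁(τ) < 0 and B₂(τ) < 0 for every τ > 0. -/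
open Set in
lemma aux_sq (x : ℝ) : HasDerivAt (fun y : ℝ => (max y 0) ^ 2) (2 * max x 0) x := by
  rcases lt_trichotomy x 0 with h | h | h
  · rw [max_eq_right h.le, mul_zero]
    refine (hasDerivAt_const x (0:ℝ)).congr_of_eventuallyEq ?_
    filter_upwards [Iio_mem_nhds h] with y hy
    rw [max_eq_right (le_of_lt hy)]; norm_num
  · subst h
    rw [max_self, mul_zero, hasDerivAt_iff_isLittleO]
    simp only [max_self, smul_zero, sub_zero]
    have h2 : (fun y : ℝ => y ^ 2) =o[nhds 0] (fun y : ℝ => y) := by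
      simpa using Asymptotics.isLittleO_pow_pow (𝕜 := ℝ) (m := 1) (n := 2) (by norm_num)
    refine Asymptotics.IsBigO.trans_isLittleO ?_ h2
    refine Asymptotics.IsBigO.of_bound 1 (Filter.Eventually.of_forall fun y => ?_)
    rw [one_mul]
    rcases le_total y 0 with hy | hy
    · rw [max_eq_right hy]; simpa using sq_nonneg y
    · rw [max_eq_left hy]; simp
  · rw [max_eq_left h.le]
    have := hasDerivAt_pow 2 x
    refine HasDerivAt.congr_of_eventuallyEq (f := fun y : ℝ => y ^ 2) (by simpa using this) ?_
    filter_upwards [Ioi_mem_nhds h] with y hy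
    rw [max_eq_left (le_of_lt hy)]

lemma aux_gron (V V' : ℝ → ℝ) (T C : ℝ) (h0 : V 0 ≤ 0)
    (hV : ∀ t ∈ Set.Ici (0:ℝ), HasDerivWithinAt V (V' t) (Set.Ici 0) t)
    (hb : ∀ t ∈ Set.Icc 0 T, V' t ≤ C * V t) : ∀ t ∈ Set.Icc 0 T, V t ≤ 0 := by
  have hW : ∀ t ∈ Set.Ici (0:ℝ), HasDerivWithinAt (fun t => V t * Real.exp (-C * t))
      (V' t * Real.exp (-C * t) + V t * (Real.exp (-C * t) * (-C))) (Set.Ici 0) t := by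
    intro t ht
    refine (hV t ht).mul (HasDerivAt.hasDerivWithinAt ?_)
    have := ((hasDerivAt_id t).const_mul (-C)).exp
    simpa using this
  intro t ht
  have := image_le_of_deriv_right_le_deriv_boundary (a := 0) (b := T)
    (f := fun t => V t * Real.exp (-C * t)) (B := fun _ => 0) (B' := fun _ => 0)
    (f' := fun t => V' t * Real.exp (-C * t) + V t * (Real.exp (-C * t) * (-C)))
    (fun t ht => ((hW t ht.1).continuousWithinAt).mono (fun s hs => hs.1))
    (fun t ht => (hW t ht.1).mono (Set.Ici_subset_Ici.2 ht.1))
    (by simpa using h0) continuousOn_const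
    (fun t _ => hasDerivWithinAt_const _ _ _)
    (fun t ht => by
      have h1 := hb t ⟨ht.1, ht.2.le⟩
      have h2 := Real.exp_pos (-C * t)
      nlinarith) ht
  have h2 := Real.exp_pos (-C * t)
  by_contra hc
  push Not at hc
  have h3 := mul_pos hc h2
  beta_reduce at *
  linarith

lemma aux_g (d κ β γ s : ℝ) (hβ : 0 ≤ β) (hγ : 0 < γ)
    (h1 : 0 < d ∨ (d = 0 ∧ κ < 0)) (h2 : 0 ≤ d - κ * γ - (β / 2) * γ ^ 2)
    (hs : 0 < s) (hs1 : s < 1) :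
    - d - κ * (-γ * s) + (β / 2) * (-γ * s) ^ 2 < 0 := by
  have e : - d - κ * (-γ * s) + (β / 2) * (-γ * s) ^ 2
      = -(1 - s) * d - s * (d - κ * γ - (β / 2) * γ ^ 2) - (β / 2) * γ ^ 2 * (s * (1 - s)) := by
    ring
  have hss : 0 < s * (1 - s) := mul_pos hs (by linarith)
  have hsh := mul_nonneg hs.le h2
  have hb : 0 ≤ (β / 2) * γ ^ 2 * (s * (1 - s)) := by positivity
  rcases h1 with h | ⟨h, hk⟩
  · have := mul_pos (sub_pos.2 hs1) h
    rw [e]; linarith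
  · subst h
    rcases hβ.eq_or_lt with h | h
    · subst h
      have := mul_pos (neg_pos.2 hk) (mul_pos hγ hs)
      linarith
    · have : 0 < (β / 2) * γ ^ 2 * (s * (1 - s)) := by positivity
      rw [e]; linarith

lemma aux_term (κ c β M x y g : ℝ) (hκ : 0 < κ) (hc : c ≤ 0) (hβ : 0 < β)
    (hx : x ≤ M) (hg : g ≤ 0) :
    2 * max x 0 * (-(κ * x) - c * y + (β / 2) * x ^ 2 + g)
      ≤ β * M * (max x 0) ^ 2 - c * ((max x 0) ^ 2 + (max y 0) ^ 2) := by
  rcases le_total x 0 with h | h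
  · rw [max_eq_right h]
    have := mul_nonneg (neg_nonneg.2 hc) (sq_nonneg (max y 0))
    nlinarith
  · rw [max_eq_left h]
    have h1 : y ≤ max y 0 := le_max_left _ _
    have h2 : 0 ≤ -c * (x * (max y 0 - y)) :=
      mul_nonneg (neg_nonneg.2 hc) (mul_nonneg h (by linarith))
    have h3 : 0 ≤ -c * (x - max y 0) ^ 2 := mul_nonneg (neg_nonneg.2 hc) (sq_nonneg _)
    have h4 : 0 ≤ β * x ^ 2 * (M - x) := mul_nonneg (by positivity) (by linarith)
    have h5 : 0 ≤ κ * x ^ 2 := by positivity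
    have h6 : 0 ≤ x * -g := mul_nonneg h (by linarith)
    nlinarith

lemma aux_strict (B : ℝ → ℝ) (D t : ℝ) (ht : 0 < t) (hB : ∀ s, 0 ≤ s → B s ≤ 0)
    (hd : HasDerivWithinAt B D (Set.Ici 0) t) (hD : B t = 0 → D < 0) : B t < 0 := by
  refine lt_of_le_of_ne (hB t ht.le) fun h => ?_
  have hd' := hd.hasDerivAt (Ici_mem_nhds ht)
  have hm : IsLocalMax B t := by
    filter_upwards [Ici_mem_nhds ht] with s hs
    rw [h]; exact hB s hs
  exact absurd (hm.hasDerivAt_eq_zero hd') (hD h).ne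

/-- **A₂(3) model, negativity of `B₁`, `B₂`.**
If for each `j = 1,2`: (i) `d_j > 0`, or `d_j = 0` and `κ_{3j} < 0`, and
(ii) `d_j - κ_{3j}γ - (β_{3j}/2)γ² ≥ 0`, then `B₁ τ < 0` and `B₂ τ < 0` for all `τ > 0`. -/
theorem stmt_16 (θ₁ θ₂ κ₁₁ κ₂₂ κ₃₃ κ₂₁ κ₁₂ κ₃₁ κ₃₂ α₃ β₁₁ β₂₂ β₃₁ β₃₂ d₀ d₁ d₂ d₃ γ : ℝ)
    (hθ₁ : 0 < θ₁) (hθ₂ : 0 < θ₂)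
    (hκ₁₁ : 0 < κ₁₁) (hκ₂₂ : 0 < κ₂₂) (hκ₃₃ : 0 < κ₃₃)
    (hκ₂₁ : κ₂₁ ≤ 0) (hκ₁₂ : κ₁₂ ≤ 0) (hΔpos : 0 < κ₁₁ * κ₂₂ - κ₁₂ * κ₂₁)
    (hα₃ : 0 < α₃) (hβ₁₁ : 0 < β₁₁) (hβ₂₂ : 0 < β₂₂)
    (hβ₃₁ : 0 ≤ β₃₁) (hβ₃₂ : 0 ≤ β₃₂)
    (hd₁ : 0 ≤ d₁) (hd₂ : 0 ≤ d₂) (hd₃ : 0 < d₃) (hγ : γ = d₃ / κ₃₃)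
    (B₃ : ℝ → ℝ) (hB₃ : ∀ τ, B₃ τ = -γ * (1 - Real.exp (-(κ₃₃ * τ))))
    (B₁ B₂ : ℝ → ℝ) (hB₁0 : B₁ 0 = 0) (hB₂0 : B₂ 0 = 0)
    (hB₁ : ∀ τ ∈ Set.Ici (0:ℝ),
      HasDerivWithinAt B₁
        (-(κ₁₁ * B₁ τ) - κ₂₁ * B₂ τ + (β₁₁ / 2) * B₁ τ ^ 2 - d₁
          - κ₃₁ * B₃ τ + (β₃₁ / 2) * B₃ τ ^ 2) (Set.Ici 0) τ)
    (hB₂ : ∀ τ ∈ Set.Ici (0:ℝ),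
      HasDerivWithinAt B₂
        (-(κ₁₂ * B₁ τ) - κ₂₂ * B₂ τ + (β₂₂ / 2) * B₂ τ ^ 2 - d₂
          - κ₃₂ * B₃ τ + (β₃₂ / 2) * B₃ τ ^ 2) (Set.Ici 0) τ)
    (h11 : 0 < d₁ ∨ (d₁ = 0 ∧ κ₃₁ < 0)) (h12 : 0 < d₂ ∨ (d₂ = 0 ∧ κ₃₂ < 0))
    (h21 : 0 ≤ d₁ - κ₃₁ * γ - (β₃₁ / 2) * γ ^ 2)
    (h22 : 0 ≤ d₂ - κ₃₂ * γ - (β₃₂ / 2) * γ ^ 2) :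
    ∀ τ > (0:ℝ), B₁ τ < 0 ∧ B₂ τ < 0 := by
  have hγp : 0 < γ := by rw [hγ]; positivity
  have hs : ∀ t, 0 < t → 0 < 1 - Real.exp (-(κ₃₃ * t)) ∧ 1 - Real.exp (-(κ₃₃ * t)) < 1 := by
    intro t ht
    have h1 : Real.exp (-(κ₃₃ * t)) < 1 := by
      rw [Real.exp_lt_one_iff]; have := mul_pos hκ₃₃ ht; linarith
    have h2 := Real.exp_pos (-(κ₃₃ * t))
    constructor <;> linarith
  have hg1 : ∀ t, 0 < t → - d₁ - κ₃₁ * B₃ t + (β₃₁ / 2) * B₃ t ^ 2 < 0 := by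
    intro t ht
    rw [hB₃]
    exact aux_g d₁ κ₃₁ β₃₁ γ _ hβ₃₁ hγp h11 h21 (hs t ht).1 (hs t ht).2
  have hg2 : ∀ t, 0 < t → - d₂ - κ₃₂ * B₃ t + (β₃₂ / 2) * B₃ t ^ 2 < 0 := by
    intro t ht
    rw [hB₃]
    exact aux_g d₂ κ₃₂ β₃₂ γ _ hβ₃₂ hγp h12 h22 (hs t ht).1 (hs t ht).2
  have hB30 : B₃ 0 = 0 := by rw [hB₃]; simp
  have hg1' : ∀ t, 0 ≤ t → - d₁ - κ₃₁ * B₃ t + (β₃₁ / 2) * B₃ t ^ 2 ≤ 0 := by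
    intro t ht
    rcases ht.eq_or_lt with h | h
    · rw [← h, hB30]; norm_num; exact hd₁
    · exact (hg1 t h).le
  have hg2' : ∀ t, 0 ≤ t → - d₂ - κ₃₂ * B₃ t + (β₃₂ / 2) * B₃ t ^ 2 ≤ 0 := by
    intro t ht
    rcases ht.eq_or_lt with h | h
    · rw [← h, hB30]; norm_num; exact hd₂
    · exact (hg2 t h).le
  have key : ∀ T, 0 ≤ T → (max (B₁ T) 0) ^ 2 + (max (B₂ T) 0) ^ 2 ≤ 0 := by
    intro T hT
    have hc1 : ContinuousOn B₁ (Set.Icc 0 T) := fun t ht =>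
      ((hB₁ t ht.1).continuousWithinAt).mono (fun s hs => hs.1)
    have hc2 : ContinuousOn B₂ (Set.Icc 0 T) := fun t ht =>
      ((hB₂ t ht.1).continuousWithinAt).mono (fun s hs => hs.1)
    obtain ⟨M₁, hM₁⟩ := (isCompact_Icc.image_of_continuousOn hc1).bddAbove
    obtain ⟨M₂, hM₂⟩ := (isCompact_Icc.image_of_continuousOn hc2).bddAbove
    have hb1 : ∀ t ∈ Set.Icc 0 T, B₁ t ≤ M₁ := fun t ht => hM₁ ⟨t, ht, rfl⟩
    have hb2 : ∀ t ∈ Set.Icc 0 T, B₂ t ≤ M₂ := fun t ht => hM₂ ⟨t, ht, rfl⟩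
    have hM1 : 0 ≤ M₁ := hB₁0 ▸ hb1 0 ⟨le_rfl, hT⟩
    have hM2 : 0 ≤ M₂ := hB₂0 ▸ hb2 0 ⟨le_rfl, hT⟩
    refine aux_gron (fun t => (max (B₁ t) 0) ^ 2 + (max (B₂ t) 0) ^ 2) _ T
      (β₁₁ * M₁ + β₂₂ * M₂ - κ₂₁ - κ₁₂) (by simp [hB₁0, hB₂0])
      (fun t ht => ((aux_sq (B₁ t)).comp_hasDerivWithinAt t (hB₁ t ht)).add
        ((aux_sq (B₂ t)).comp_hasDerivWithinAt t (hB₂ t ht))) ?_ T ⟨hT, le_rfl⟩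
    intro t ht
    have e1 := aux_term κ₁₁ κ₂₁ β₁₁ M₁ (B₁ t) (B₂ t) _ hκ₁₁ hκ₂₁ hβ₁₁ (hb1 t ht) (hg1' t ht.1)
    have e2 := aux_term κ₂₂ κ₁₂ β₂₂ M₂ (B₂ t) (B₁ t) _ hκ₂₂ hκ₁₂ hβ₂₂ (hb2 t ht) (hg2' t ht.1)
    have e3 : 0 ≤ β₁₁ * M₁ * (max (B₂ t) 0) ^ 2 := by positivity
    have e4 : 0 ≤ β₂₂ * M₂ * (max (B₁ t) 0) ^ 2 := by positivity
    linarith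
  have hn1 : ∀ t, 0 ≤ t → B₁ t ≤ 0 := by
    intro t ht
    have h := key t ht
    have h2 : (max (B₁ t) 0) ^ 2 = 0 :=
      le_antisymm (by linarith [sq_nonneg (max (B₂ t) 0)]) (sq_nonneg _)
    exact max_eq_right_iff.1 (pow_eq_zero_iff (two_ne_zero) |>.1 h2)
  have hn2 : ∀ t, 0 ≤ t → B₂ t ≤ 0 := by
    intro t ht
    have h := key t ht
    have h2 : (max (B₂ t) 0) ^ 2 = 0 :=
      le_antisymm (by linarith [sq_nonneg (max (B₁ t) 0)]) (sq_nonneg _)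
    exact max_eq_right_iff.1 (pow_eq_zero_iff (two_ne_zero) |>.1 h2)
  intro t ht
  refine ⟨aux_strict B₁ _ t ht hn1 (hB₁ t ht.le) fun h => ?_,
    aux_strict B₂ _ t ht hn2 (hB₂ t ht.le) fun h => ?_⟩
  · have := mul_nonneg_of_nonpos_of_nonpos hκ₂₁ (hn2 t ht.le)
    rw [h]; linarith [hg1 t ht]
  · have := mul_nonneg_of_nonpos_of_nonpos hκ₁₂ (hn1 t ht.le)
    rw [h]; linarith [hg2 t ht]
end
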